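/- arXiv:1305.1603 — 3 statements merged into one kernel-verified Lean document; each statement's English description precedes it below -/
import Mathlib

section
/- Let λ₀ = (m/(σ₊−σ₋))·∫_{σ₋}^{σ₊} r^{2s} dr. Then λ₀ < 1, and for every k ≥ 1 the random variable X_k(ω) = ∑_{i ∈ J_k} (𝐫_i^ω)^s satisfies E(X_k²) ≤ 1 + λ₀/(1−λ₀); in particular sup_k E(X_k²) < ∞. -/
open MeasureTheory Filter Topology
open scoped ENNReal

noncomputable section

abbrev E (d : ℕ) : Type := EuclideanSpace ℝ (Fin d)

abbrev Od (d : ℕ) : Type := Matrix.orthogonalGroup (Fin d) ℝ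

instance (d : ℕ) : MeasurableSpace (Od d) := borel _
instance (d : ℕ) : BorelSpace (Od d) := ⟨rfl⟩

/-- The action of an orthogonal matrix on Euclidean space, as a linear map. -/
def act (d : ℕ) (Q : Od d) : E d →ₗ[ℝ] E d :=
  Matrix.toEuclideanLin (Q : Matrix (Fin d) (Fin d) ℝ)

/-- The set `J` of finite nonempty words: a word of length `k+1` is a function
`Fin (k+1) → Fin m`. -/
abbrev JW (m : ℕ) : Type := Σ k : ℕ, (Fin (k + 1) → Fin m)

noncomputable instance (m : ℕ) : DecidableEq (JW m) := fun _ _ => Classical.dec _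

/-- The label space `(σ₋,σ₊) × O(d)`. -/
abbrev Label (d : ℕ) (σm σp : ℝ) : Type := ↥(Set.Ioo σm σp) × Od d

/-- The space `Ω` of labelled trees. -/
abbrev Omega (d m : ℕ) (σm σp : ℝ) : Type := JW m → Label d σm σp

variable {d m : ℕ} {σm σp : ℝ}

/-- The similarity map `T_i^ω = r_i^ω • Q_i^ω` attached to the node `w`. -/
def Tnode (ω : Omega d m σm σp) (w : JW m) : E d →ₗ[ℝ] E d :=
  ((ω w).1 : ℝ) • act d (ω w).2

/-- The initial word `𝐢_{k+1}` (first `k+1` symbols) of an infinite word `i`. -/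
def pre (i : ℕ → Fin m) (k : ℕ) : JW m := ⟨k, fun j => i j.1⟩

/-- `cumT ω i n = T_{𝐢_1} ∘ ⋯ ∘ T_{𝐢_n}`. -/
def cumT (ω : Omega d m σm σp) (i : ℕ → Fin m) : ℕ → (E d →ₗ[ℝ] E d)
  | 0 => LinearMap.id
  | n + 1 => (cumT ω i n).comp (Tnode ω (pre i n))

/-- `cumR ω i n = 𝐫_{𝐢_n}^ω = r_{𝐢_1}^ω ⋯ r_{𝐢_n}^ω` (equal to 1 if `n = 0`). -/
def cumR (ω : Omega d m σm σp) (i : ℕ → Fin m) (n : ℕ) : ℝ :=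
  ∏ k ∈ Finset.range n, ((ω (pre i k)).1 : ℝ)

/-- `𝐫_w^ω` for a finite word `w`. -/
def wordR (ω : Omega d m σm σp) {k : ℕ} (w : Fin k → Fin m) : ℝ :=
  ∏ j : Fin k, ((ω ⟨j.1, fun t => w (Fin.castLE j.2 t)⟩).1 : ℝ)

/-- The `k`-th partial sum `a_{i_1} + T_{𝐢_1}(a_{i_2}) + ⋯ + T_{𝐢_1}∘⋯∘T_{𝐢_k}(a_{i_{k+1}})`. -/
def partialSum (a : Fin m → E d) (ω : Omega d m σm σp) (i : ℕ → Fin m) (k : ℕ) : E d :=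
  ∑ n ∈ Finset.range (k + 1), cumT ω i n (a (i n))

/-- The point `π(i, ω)`. -/
def piMap (a : Fin m → E d) (ω : Omega d m σm σp) (i : ℕ → Fin m) : E d :=
  ∑' n : ℕ, cumT ω i n (a (i n))

/-- `cumTFrom ω i p q = T_{𝐢_{p+2}} ∘ ⋯ ∘ T_{𝐢_{p+1+q}}`. -/
def cumTFrom (ω : Omega d m σm σp) (i : ℕ → Fin m) (p : ℕ) : ℕ → (E d →ₗ[ℝ] E d)
  | 0 => LinearMap.id
  | q + 1 => (cumTFrom ω i p q).comp (Tnode ω (pre i (p + 1 + q)))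

/-- The random vector `x(i, ω, p)`. -/
def xMap (a : Fin m → E d) (ω : Omega d m σm σp) (i : ℕ → Fin m) (p : ℕ) : E d :=
  ∑' q : ℕ, cumTFrom ω i p q (a (i (p + 1 + q)))

/-- The uniform probability measure on `(σ₋, σ₊)`, as a measure on `ℝ`. -/
def unif (σm σp : ℝ) : Measure ℝ :=
  (ENNReal.ofReal (σp - σm))⁻¹ • (volume.restrict (Set.Ioo σm σp))

/-- The uniform probability measure on `(σ₋, σ₊)`, as a measure on the subtype. -/
def unifSub (σm σp : ℝ) : Measure ↥(Set.Ioo σm σp) :=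
  (ENNReal.ofReal (σp - σm))⁻¹ • ((volume : Measure ℝ).comap Subtype.val)

/-- The measure `λ × θ` on the label space. -/
def labelM (σm σp : ℝ) {d : ℕ} (θ : Measure (Od d)) : Measure (Label d σm σp) :=
  (unifSub σm σp).prod θ

/-- The cylinder `[w]` of a finite word `w`. -/
def cyl {m k : ℕ} (w : Fin k → Fin m) : Set (ℕ → Fin m) := {j | ∀ t : Fin k, j t.1 = w t}

/-- The cylinder `[w]` of a node `w : JW m`. -/
def cylNode {m : ℕ} (w : JW m) : Set (ℕ → Fin m) := {j | ∀ t : Fin (w.1 + 1), j t.1 = w.2 t}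

/-- The σ-algebra `𝓕_k` generated by the labels at nodes of length at most `k`. -/
def Fk (d m : ℕ) (σm σp : ℝ) (k : ℕ) : MeasurableSpace (Omega d m σm σp) :=
  ⨆ w : {w : JW m // w.1 + 1 ≤ k}, MeasurableSpace.comap (fun ω => ω w.1) inferInstance

/-- `P` is the product measure `(λ×θ)^J`: coordinates are independent with law `λ×θ`. -/
def IsProductLaw (θ : Measure (Od d)) (P : Measure (Omega d m σm σp)) : Prop :=
  ∀ (S : Finset (JW m)) (A : JW m → Set (Label d σm σp)),
    (∀ w, MeasurableSet (A w)) →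
    P {ω | ∀ w ∈ S, ω w ∈ A w} = ∏ w ∈ S, labelM σm σp θ (A w)

/-- The uniformly random self-similar set `F(ω)`. -/
def Fset (a : Fin m → E d) (ω : Omega d m σm σp) : Set (E d) := Set.range (piMap a ω)

/-- `w` is an initial subword of `v`. -/
def isPrefix {m : ℕ} (w v : JW m) : Prop :=
  ∃ h : w.1 ≤ v.1, ∀ t : Fin (w.1 + 1), v.2 (Fin.castLE (Nat.succ_le_succ h) t) = w.2 t

end

lemma aux_prod_ite {α : Type} [Fintype α] (a : α) [∀ x, Decidable (x = a)] (F : α → ℝ) :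
    ∏ x, (if x = a then F x else 1) = F a := by
  rw [Finset.prod_eq_single a]
  · simp
  · intro b _ hb
    simp [hb]
  · simp

open ProbabilityTheory in
lemma aux_indep_integral {d m : ℕ} {σm σp : ℝ} (hσ : σm < σp)
    (θ : Measure (Od d)) (hθ1 : IsProbabilityMeasure θ)
    (P : Measure (Omega d m σm σp))
    (hP2 : IsProductLaw θ P) {ι : Type} [Fintype ι] (g : ι → JW m) (hg : Function.Injective g)
    (f : ι → ℝ → ℝ) (hf : ∀ i, Measurable (f i)) :
    ∫ ω, ∏ i, f i ((ω (g i)).1 : ℝ) ∂P =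
      ∏ i, ((1 / (σp - σm)) * ∫ r in σm..σp, f i r) := by
  have hpos : 0 < σp - σm := sub_pos.2 hσ
  have hU : IsProbabilityMeasure (unifSub σm σp) := by
    constructor
    unfold unifSub
    rw [Measure.smul_apply, comap_subtype_coe_apply measurableSet_Ioo]
    simp only [Set.image_univ, Subtype.range_coe_subtype, Set.ofPred_mem_eq, Real.volume_Ioo,
      smul_eq_mul]
    exact ENNReal.inv_mul_cancel (by simpa using hσ) ENNReal.ofReal_ne_top
  have hL : IsProbabilityMeasure (labelM σm σp θ) := by unfold labelM; infer_instance
  have hP : P = Measure.infinitePi (fun _ : JW m => labelM σm σp θ) := by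
    apply Measure.eq_infinitePi
    intro S A hA
    exact hP2 S A hA
  have h1 : iIndepFun (fun i (ω : Omega d m σm σp) => ω (g i)) P := by
    rw [hP]
    exact iIndepFun.precomp hg (iIndepFun_infinitePi (X := fun _ x => x) (by fun_prop))
  have hfm : ∀ i, Measurable (fun x : Label d σm σp => f i (x.1 : ℝ)) := fun i =>
    (hf i).comp (measurable_subtype_coe.comp measurable_fst)
  have h2 := h1.integral_fun_prod_comp (f := fun i (x : Label d σm σp) => f i (x.1 : ℝ))
    (fun i => (measurable_pi_apply _).aemeasurable) (fun i => (hfm i).aestronglyMeasurable)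
  rw [h2]
  refine Finset.prod_congr rfl fun i _ => ?_
  have h3 : ∫ ω, f i ((ω (g i)).1 : ℝ) ∂P = ∫ x, f i (x.1 : ℝ) ∂(labelM σm σp θ) := by
    have hmp := measurePreserving_eval_infinitePi (fun _ : JW m => labelM σm σp θ) (g i)
    rw [← hP] at hmp
    rw [← hmp.map_eq, integral_map hmp.measurable.aemeasurable (hfm i).aestronglyMeasurable]
  rw [h3]
  unfold labelM
  rw [integral_fun_fst (fun x : Set.Ioo σm σp => f i (x : ℝ))]
  unfold unifSub
  rw [integral_smul_measure, integral_subtype_comap measurableSet_Ioo (f i),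
    intervalIntegral.integral_of_le hσ.le, integral_Ioc_eq_integral_Ioo]
  simp [ENNReal.toReal_ofReal hpos.le]

/-- the pair correlation -/
def auxA {m : ℕ} (p q : ℝ) {k : ℕ} (w v : Fin k → Fin m) : ℝ :=
  ∏ j : Fin k, if (fun t : Fin (j.1+1) => w (Fin.castLE j.2 t)) = (fun t => v (Fin.castLE j.2 t))
    then q else p * p

lemma auxA_self {m : ℕ} (p q : ℝ) {k : ℕ} (w : Fin k → Fin m) : auxA p q w w = q ^ k := by
  simp [auxA]

lemma auxA_snoc {m : ℕ} (p q : ℝ) {k : ℕ} (w v : Fin k → Fin m) (a b : Fin m) :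
    auxA p q (Fin.snoc w a : Fin (k+1) → Fin m) (Fin.snoc v b : Fin (k+1) → Fin m) =
      auxA p q w v * (if w = v ∧ a = b then q else p * p) := by
  unfold auxA
  rw [Fin.prod_univ_castSucc]
  congr 1
  · refine Finset.prod_congr rfl fun j _ => ?_
    have key : ∀ (u : Fin k → Fin m) (c : Fin m) (t : Fin (j.castSucc.1 + 1)),
        (Fin.snoc u c : Fin (k+1) → Fin m) (Fin.castLE j.castSucc.2 t)
          = u (Fin.castLE j.2 t) := fun u c t => by
      have : Fin.castLE j.castSucc.2 t = (Fin.castLE j.2 t : Fin k).castSucc := by ext; simp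
      rw [this, Fin.snoc_castSucc]
    simp only [key]
    rfl
  · have key : ((fun t : Fin ((Fin.last k).1+1) => (Fin.snoc w a : Fin (k+1) → Fin m)
        (Fin.castLE (Fin.last k).2 t)) = (fun t => (Fin.snoc v b : Fin (k+1) → Fin m)
        (Fin.castLE (Fin.last k).2 t))) ↔ (w = v ∧ a = b) := by
      have : (fun t : Fin ((Fin.last k).1+1) => (Fin.snoc w a : Fin (k+1) → Fin m)
        (Fin.castLE (Fin.last k).2 t)) = (Fin.snoc w a : Fin (k+1) → Fin m) := by
        funext t; congr 1
      have h' : (fun t : Fin ((Fin.last k).1+1) => (Fin.snoc v b : Fin (k+1) → Fin m)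
        (Fin.castLE (Fin.last k).2 t)) = (Fin.snoc v b : Fin (k+1) → Fin m) := by
        funext t; congr 1
      rw [this, h']
      constructor
      · intro h
        exact ⟨by simpa using congrArg Fin.init h, by simpa using congrFun h (Fin.last k)⟩
      · rintro ⟨rfl, rfl⟩; rfl
    simp only [key]

lemma aux_sum_snoc {m k : ℕ} (F : (Fin (k+1) → Fin m) → ℝ) :
    ∑ w, F w = ∑ w : Fin k → Fin m, ∑ a : Fin m, F (Fin.snoc w a) := by
  rw [← (Fin.snocEquiv (fun _ : Fin (k+1) => Fin m)).sum_comp, Fintype.sum_prod_type,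
    Finset.sum_comm]
  rfl

lemma auxA_sum {m : ℕ} (p q : ℝ) (hq : 0 ≤ q) (hp : m * p = 1) (k : ℕ) :
    ∑ w : Fin k → Fin m, ∑ v : Fin k → Fin m, auxA p q w v ≤
      ∑ l ∈ Finset.range (k+1), (m * q) ^ l := by
  induction k with
  | zero => simp [auxA]
  | succ k ih =>
    rw [Finset.sum_range_succ]
    have hstep : ∀ w v : Fin k → Fin m,
        ∑ a : Fin m, ∑ b : Fin m, auxA p q w v * (if w = v ∧ a = b then q else p * p) ≤
        auxA p q w v + (if w = v then q ^ k * (m * q) else 0) := by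
      intro w v
      have hone : (m : ℝ) * (m * (p * p)) = 1 := by
        calc (m : ℝ) * (m * (p * p)) = (m * p) * (m * p) := by ring
          _ = 1 := by rw [hp]; ring
      by_cases h : w = v
      · subst h
        simp only [true_and, if_true, auxA_self]
        simp only [← Finset.mul_sum]
        have : ∑ a : Fin m, ∑ b : Fin m, (if a = b then q else p * p) ≤
            ∑ a : Fin m, ∑ b : Fin m, (p * p + if a = b then q else 0) := by
          refine Finset.sum_le_sum fun a _ => Finset.sum_le_sum fun b _ => ?_
          split_ifs <;> nlinarith [mul_self_nonneg p]
        have h2 : ∑ a : Fin m, ∑ b : Fin m, (p * p + if a = b then q else 0) = 1 + m * q := by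
          simp [Finset.sum_add_distrib, hone]
        calc _ ≤ q ^ k * (1 + m * q) := by
              rw [← h2]; exact mul_le_mul_of_nonneg_left this (pow_nonneg hq k)
          _ = _ := by ring
      · simp only [h, false_and, if_false, add_zero]
        simp only [Finset.sum_const, Finset.card_univ, Fintype.card_fin, nsmul_eq_mul]
        apply le_of_eq
        linear_combination (auxA p q w v) * hone
    calc _ = ∑ w : Fin k → Fin m, ∑ v : Fin k → Fin m, ∑ a : Fin m, ∑ b : Fin m,
            auxA p q w v * (if w = v ∧ a = b then q else p * p) := by
          rw [aux_sum_snoc]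
          refine Finset.sum_congr rfl fun w _ => ?_
          simp_rw [aux_sum_snoc, auxA_snoc]
          rw [Finset.sum_comm]
      _ ≤ ∑ w : Fin k → Fin m, ∑ v : Fin k → Fin m,
            (auxA p q w v + (if w = v then q ^ k * (m * q) else 0)) :=
          Finset.sum_le_sum fun w _ => Finset.sum_le_sum fun v _ => hstep w v
      _ = (∑ w : Fin k → Fin m, ∑ v : Fin k → Fin m, auxA p q w v) + (m * q) ^ (k+1) := by
          simp only [Finset.sum_add_distrib, Finset.sum_ite_eq, Finset.mem_univ, if_true,
            Finset.sum_const, Finset.card_univ, Fintype.card_fun, Fintype.card_fin, nsmul_eq_mul]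
          push_cast
          ring
      _ ≤ _ := by gcongr

lemma aux_pair {d m : ℕ} {σm σp : ℝ} (hσ0 : 0 < σm) (hσ : σm < σp)
    (θ : Measure (Od d)) (hθ1 : IsProbabilityMeasure θ)
    (P : Measure (Omega d m σm σp))
    (hP2 : IsProductLaw θ P) (s : ℝ) {k : ℕ} (w v : Fin k → Fin m) :
    ∫ ω, wordR ω w ^ s * wordR ω v ^ s ∂P =
      auxA ((1 / (σp - σm)) * ∫ r in σm..σp, r ^ s)
        ((1 / (σp - σm)) * ∫ r in σm..σp, r ^ (2 * s)) w v := by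
  classical
  have hpos : 0 < σp - σm := sub_pos.2 hσ
  let g : (Σ j : Fin k, (Fin (j.1 + 1) → Fin m)) → JW m := fun u => ⟨u.1.1, u.2⟩
  have hg : Function.Injective g := by
    rintro ⟨⟨j, hj⟩, z⟩ ⟨⟨j', hj'⟩, z'⟩ h
    simp only [g, Sigma.mk.injEq] at h
    obtain ⟨rfl, h⟩ := h
    rw [eq_of_heq h]
  let f : (Σ j : Fin k, (Fin (j.1 + 1) → Fin m)) → ℝ → ℝ := fun u r =>
    (if u.2 = (fun t => w (Fin.castLE u.1.2 t)) then r ^ s else 1) *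
    (if u.2 = (fun t => v (Fin.castLE u.1.2 t)) then r ^ s else 1)
  have hf : ∀ u, Measurable (f u) := by
    intro u
    simp only [f]
    split_ifs <;> fun_prop
  have h1 := aux_indep_integral hσ θ hθ1 P hP2 g hg f hf
  have hL : ∀ ω : Omega d m σm σp, ∏ u, f u ((ω (g u)).1 : ℝ) =
      wordR ω w ^ s * wordR ω v ^ s := by
    intro ω
    have hr : ∀ x : Label d σm σp, 0 ≤ (x.1 : ℝ) := fun x => hσ0.le.trans x.1.2.1.le
    rw [Fintype.prod_sigma]
    unfold wordR
    rw [← Real.finsetProd_rpow _ _ (fun i _ => hr _), ← Real.finsetProd_rpow _ _ (fun i _ => hr _),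
      ← Finset.prod_mul_distrib]
    refine Finset.prod_congr rfl fun j _ => ?_
    simp only [f, Finset.prod_mul_distrib, g]
    congr 1
    · convert! aux_prod_ite (fun t : Fin (j.1+1) => w (Fin.castLE j.2 t)) (fun z => ((ω ⟨j.1, z⟩).1 : ℝ) ^ s)
    · convert! aux_prod_ite (fun t : Fin (j.1+1) => v (Fin.castLE j.2 t)) (fun z => ((ω ⟨j.1, z⟩).1 : ℝ) ^ s)
  simp_rw [hL] at h1
  rw [h1, Fintype.prod_sigma]
  unfold auxA
  refine Finset.prod_congr rfl fun j _ => ?_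
  have hdbl : ∫ r in σm..σp, r ^ s * r ^ s = ∫ r in σm..σp, r ^ (2 * s) := by
    refine intervalIntegral.integral_congr fun r hr => ?_
    rw [Set.uIcc_of_le hσ.le] at hr
    rw [← Real.rpow_add (hσ0.trans_le hr.1), two_mul]
  have hc : (1 / (σp - σm)) * ∫ r in σm..σp, (1:ℝ) = 1 := by
    simp; field_simp
  set W : Fin (j.1+1) → Fin m := fun t => w (Fin.castLE j.2 t) with hW
  set V : Fin (j.1+1) → Fin m := fun t => v (Fin.castLE j.2 t) with hV
  by_cases h : W = V
  · rw [if_pos h]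
    have : ∀ z : Fin (j.1+1) → Fin m, (1 / (σp - σm)) * ∫ r in σm..σp, f ⟨j, z⟩ r =
        if z = W then (1 / (σp - σm)) * ∫ r in σm..σp, r ^ (2 * s) else 1 := by
      intro z
      simp only [f, ← hW, ← hV, ← h]
      split_ifs
      · rw [hdbl]
      · simpa using hc
    simp_rw [this]
    simp
  · rw [if_neg h]
    have : ∀ z : Fin (j.1+1) → Fin m, (1 / (σp - σm)) * ∫ r in σm..σp, f ⟨j, z⟩ r =
        (if z = W then (1 / (σp - σm)) * ∫ r in σm..σp, r ^ s else 1) *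
        (if z = V then (1 / (σp - σm)) * ∫ r in σm..σp, r ^ s else 1) := by
      intro z
      simp only [f, ← hW, ← hV]
      split_ifs with h1 h2
      · exact absurd (h1.symm.trans h2) h
      · simp
      · simp
      · simpa using hc
    simp_rw [this]
    rw [Finset.prod_mul_distrib]
    simp

lemma aux_wordR_mem {d m : ℕ} {σm σp : ℝ} (hσ0 : 0 < σm) (hσ2 : σp < 1)
    {k : ℕ} (ω : Omega d m σm σp) (w : Fin k → Fin m) : 0 ≤ wordR ω w ∧ wordR ω w ≤ 1 := by
  unfold wordR
  have hr : ∀ x : Label d σm σp, 0 ≤ (x.1 : ℝ) := fun x => hσ0.le.trans x.1.2.1.le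
  exact ⟨Finset.prod_nonneg fun i _ => hr _,
    Finset.prod_le_one (fun i _ => hr _) fun i _ => ((ω _).1.2.2.trans hσ2).le⟩

lemma aux_int {d m : ℕ} {σm σp : ℝ} (hσ0 : 0 < σm) (hσ2 : σp < 1)
    (P : Measure (Omega d m σm σp)) [IsProbabilityMeasure P] (s : ℝ) (hs : 0 < s)
    {k : ℕ} (w v : Fin k → Fin m) :
    Integrable (fun ω => wordR ω w ^ s * wordR ω v ^ s) P := by
  have hm : ∀ u : Fin k → Fin m, Measurable (fun ω : Omega d m σm σp => wordR ω u) := by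
    intro u
    unfold wordR
    refine Finset.measurable_prod _ fun j _ => ?_
    exact measurable_subtype_coe.comp (measurable_fst.comp (measurable_pi_apply _))
  refine Integrable.of_bound (C := 1)
    (((hm w).pow_const s).mul ((hm v).pow_const s)).aestronglyMeasurable
    (Eventually.of_forall fun ω => ?_)
  obtain ⟨a0, a1⟩ := aux_wordR_mem hσ0 hσ2 ω w
  obtain ⟨b0, b1⟩ := aux_wordR_mem hσ0 hσ2 ω v
  rw [Real.norm_of_nonneg (by positivity)]
  exact mul_le_one₀ (Real.rpow_le_one a0 a1 hs.le) (by positivity) (Real.rpow_le_one b0 b1 hs.le)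

/-- With `λ₀ = (m/(σ₊−σ₋))·∫_{σ₋}^{σ₊} r^{2s} dr` one has `λ₀ < 1`, and the martingale
`X_k(ω) = ∑_{i ∈ J_k} (𝐫_i^ω)^s` is `L²`-bounded: `E(X_k²) ≤ 1 + λ₀/(1−λ₀)` for `k ≥ 1`. -/
theorem stmt10 (d m : ℕ) (hd : 1 ≤ d) (hm : 2 ≤ m)
    (σm σp : ℝ) (hσ0 : 0 < σm) (hσ1 : σm ≤ σp) (hσ2 : σp < 1)
    (θ : Measure (Od d)) (hθ1 : IsProbabilityMeasure θ) (hθ2 : θ.IsMulLeftInvariant)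
    (P : Measure (Omega d m σm σp)) (hP1 : IsProbabilityMeasure P)
    (hP2 : IsProductLaw θ P)
    (s : ℝ) (hs0 : 0 < s)
    (hs : ((m : ℝ) / (σp - σm)) * (∫ r in σm..σp, r ^ s) = 1) :
    ((m : ℝ) / (σp - σm)) * (∫ r in σm..σp, r ^ (2 * s)) < 1 ∧
    ∀ k : ℕ, 1 ≤ k →
      ∫ ω, (∑ w : Fin k → Fin m, wordR ω w ^ s) ^ 2 ∂P
        ≤ 1 + (((m : ℝ) / (σp - σm)) * ∫ r in σm..σp, r ^ (2 * s)) /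
            (1 - ((m : ℝ) / (σp - σm)) * ∫ r in σm..σp, r ^ (2 * s)) := by
  have hσ : σm < σp := by
    rcases hσ1.lt_or_eq with h | h
    · exact h
    · subst h; simp at hs
  have hpos : 0 < σp - σm := sub_pos.2 hσ
  have hm0 : (0:ℝ) < m := by exact_mod_cast (by omega : 0 < m)
  have hint : ∀ t : ℝ, IntervalIntegrable (fun r : ℝ => r ^ t) volume σm σp := fun t =>
    intervalIntegral.intervalIntegrable_rpow (Or.inr (by
      rw [Set.uIcc_of_le hσ.le]; exact fun h => absurd h.1 (not_le.2 hσ0)))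
  have hlt : ((m : ℝ) / (σp - σm)) * (∫ r in σm..σp, r ^ (2 * s)) < 1 := by
    have hle : ∫ r in σm..σp, r ^ (2 * s) ≤ ∫ r in σm..σp, σp ^ s * r ^ s := by
      refine intervalIntegral.integral_mono_on hσ.le (hint _) ((hint s).const_mul _) fun r hr => ?_
      have hr0 : 0 < r := hσ0.trans_le hr.1
      rw [two_mul, Real.rpow_add hr0]
      exact mul_le_mul_of_nonneg_right (Real.rpow_le_rpow hr0.le hr.2 hs0.le) (by positivity)
    rw [intervalIntegral.integral_const_mul] at hle
    calc _ ≤ ((m : ℝ) / (σp - σm)) * (σp ^ s * ∫ r in σm..σp, r ^ s) :=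
          mul_le_mul_of_nonneg_left hle (by positivity)
      _ = σp ^ s * (((m : ℝ) / (σp - σm)) * ∫ r in σm..σp, r ^ s) := by ring
      _ = σp ^ s := by rw [hs, mul_one]
      _ < 1 := Real.rpow_lt_one (hσ0.le.trans hσ.le) hσ2 hs0
  refine ⟨hlt, fun k _ => ?_⟩
  have hq : 0 ≤ (1 / (σp - σm)) * ∫ r in σm..σp, r ^ (2 * s) :=
    mul_nonneg (by positivity) (intervalIntegral.integral_nonneg hσ.le fun r hr =>
      Real.rpow_nonneg (hσ0.le.trans hr.1) _)
  have hp : (m:ℝ) * ((1 / (σp - σm)) * ∫ r in σm..σp, r ^ s) = 1 := by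
    refine Eq.trans ?_ hs
    ring
  have hmq : (m:ℝ) * ((1 / (σp - σm)) * ∫ r in σm..σp, r ^ (2 * s)) =
    ((m : ℝ) / (σp - σm)) * (∫ r in σm..σp, r ^ (2 * s)) := by ring
  have hE : ∫ ω, (∑ w : Fin k → Fin m, wordR ω w ^ s) ^ 2 ∂P =
      ∑ w : Fin k → Fin m, ∑ v : Fin k → Fin m,
        auxA ((1 / (σp - σm)) * ∫ r in σm..σp, r ^ s)
        ((1 / (σp - σm)) * ∫ r in σm..σp, r ^ (2 * s)) w v := by
    simp_rw [sq, Finset.sum_mul_sum]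
    rw [integral_finsetSum _ fun w _ => integrable_finsetSum _ fun v _ =>
      aux_int hσ0 hσ2 P s hs0 w v]
    refine Finset.sum_congr rfl fun w _ => ?_
    rw [integral_finsetSum _ fun v _ => aux_int hσ0 hσ2 P s hs0 w v]
    exact Finset.sum_congr rfl fun v _ => aux_pair hσ0 hσ θ hθ1 P hP2 s w v
  rw [hE]
  refine (auxA_sum _ _ hq hp k).trans ?_
  rw [hmq]
  have hl0 : 0 ≤ ((m : ℝ) / (σp - σm)) * (∫ r in σm..σp, r ^ (2 * s)) := by
    rw [← hmq]; exact mul_nonneg hm0.le hq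
  generalize ((m : ℝ) / (σp - σm)) * (∫ r in σm..σp, r ^ (2 * s)) = L at hlt hl0 ⊢
  have h1L : 0 < 1 - L := sub_pos.2 hlt
  have hrw : 1 + L / (1 - L) = 1 / (1 - L) := by field_simp; ring
  rw [hrw, le_div_iff₀ h1L, geom_sum_mul_neg]
  have := pow_nonneg hl0 (k+1)
  linarith
end

section
/- For ℙ-almost every ω ∈ Ω, the s-dimensional Hausdorff measure of the uniformly random self-similar set F(ω) is finite: ℋ^s(F(ω)) < ∞. -/
open MeasureTheory Filter Topology
open scoped ENNReal

lemma norm_act (d : ℕ) (Q : Od d) (x : E d) : ‖act d Q x‖ = ‖x‖ := by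
  have h : (Q : Matrix (Fin d) (Fin d) ℝ).transpose * (Q : Matrix (Fin d) (Fin d) ℝ) = 1 := by
    have := (Matrix.mem_orthogonalGroup_iff' (Fin d) ℝ).1 Q.2
    simpa [Matrix.star_eq_conjTranspose] using this
  have h2 : ‖act d Q x‖ ^ 2 = ‖x‖ ^ 2 := by
    rw [← real_inner_self_eq_norm_sq, ← real_inner_self_eq_norm_sq]
    simp only [act, EuclideanSpace.inner_eq_star_dotProduct, Matrix.toLpLin_apply, star_trivial]
    rw [Matrix.dotProduct_mulVec, Matrix.vecMul_mulVec, h, Matrix.vecMul_one]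
  nlinarith [norm_nonneg (act d Q x), norm_nonneg x, sq_nonneg (‖act d Q x‖ - ‖x‖), sq_nonneg (‖act d Q x‖ + ‖x‖), (pow_left_inj₀ (norm_nonneg (act d Q x)) (norm_nonneg x) two_ne_zero).1 h2]

lemma norm_cumT {d m : ℕ} {σm σp : ℝ} (hσ0 : 0 < σm) (ω : Omega d m σm σp) (i : ℕ → Fin m)
    (n : ℕ) (x : E d) : ‖cumT ω i n x‖ = cumR ω i n * ‖x‖ := by
  induction n generalizing x with
  | zero => simp [cumT, cumR]
  | succ n ih =>
    have h0 : 0 < ((ω (pre i n)).1 : ℝ) := hσ0.trans (ω (pre i n)).1.2.1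
    have : cumR ω i (n+1) = cumR ω i n * ((ω (pre i n)).1 : ℝ) := by
      simp [cumR, Finset.prod_range_succ]
    rw [cumT, LinearMap.comp_apply, ih, this, Tnode, LinearMap.smul_apply, norm_smul, norm_act,
      Real.norm_of_nonneg h0.le, mul_assoc]

lemma cumR_nonneg {d m : ℕ} {σm σp : ℝ} (hσ0 : 0 < σm) (ω : Omega d m σm σp) (i : ℕ → Fin m)
    (n : ℕ) : 0 ≤ cumR ω i n :=
  Finset.prod_nonneg fun k _ => (hσ0.trans (ω (pre i k)).1.2.1).le

lemma cumR_le {d m : ℕ} {σm σp : ℝ} (hσ0 : 0 < σm) (ω : Omega d m σm σp) (i : ℕ → Fin m)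
    (k n : ℕ) : cumR ω i (n + k) ≤ cumR ω i k * σp ^ n := by
  induction n with
  | zero => simp
  | succ n ih =>
    have h0 : 0 < ((ω (pre i (n+k))).1 : ℝ) := hσ0.trans (ω (pre i (n+k))).1.2.1
    have h1 : ((ω (pre i (n+k))).1 : ℝ) < σp := (ω (pre i (n+k))).1.2.2
    have : cumR ω i (n+k+1) = cumR ω i (n+k) * ((ω (pre i (n+k))).1 : ℝ) := by
      simp [cumR, Finset.prod_range_succ]
    rw [Nat.add_right_comm, this, pow_succ, ← mul_assoc]
    exact mul_le_mul ih h1.le h0.le ((cumR_nonneg hσ0 ω i _).trans ih)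

lemma tail_bound {d m : ℕ} {σm σp : ℝ} (hσ0 : 0 < σm) (hp0 : 0 < σp) (hσ2 : σp < 1)
    (a : Fin m → E d) (A : ℝ) (hA : ∀ j, ‖a j‖ ≤ A) (ω : Omega d m σm σp) (i : ℕ → Fin m)
    (k : ℕ) : Summable (fun n => cumT ω i (n + k) (a (i (n + k)))) ∧
      ‖∑' n, cumT ω i (n + k) (a (i (n + k)))‖ ≤ cumR ω i k * A * (1 - σp)⁻¹ := by
  have hb : ∀ n, ‖cumT ω i (n + k) (a (i (n + k)))‖ ≤ cumR ω i k * A * σp ^ n := by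
    intro n
    rw [norm_cumT hσ0]
    calc _ ≤ (cumR ω i k * σp ^ n) * A :=
          mul_le_mul (cumR_le hσ0 ω i k n) (hA _) (norm_nonneg _)
            (mul_nonneg (cumR_nonneg hσ0 ω i k) (pow_nonneg hp0.le n))
      _ = _ := by ring
  have hg := (hasSum_geometric_of_lt_one hp0.le hσ2).mul_left (cumR ω i k * A)
  exact ⟨Summable.of_norm_bounded hg.summable hb, tsum_of_norm_bounded hg hb⟩

lemma cumR_eq_wordR {d m : ℕ} {σm σp : ℝ} (ω : Omega d m σm σp) {k : ℕ} (w : Fin k → Fin m)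
    (i : ℕ → Fin m) (hi : i ∈ cyl w) : cumR ω i k = wordR ω w := by
  rw [cumR, wordR, Finset.prod_range]
  refine Finset.prod_congr rfl fun j _ => ?_
  have : pre i j.1 = ⟨j.1, fun t => w (Fin.castLE j.2 t)⟩ := by
    simp only [pre]
    congr 1
    funext t
    exact hi (Fin.castLE j.2 t)
  rw [this]

lemma cumT_congr {d m : ℕ} {σm σp : ℝ} (ω : Omega d m σm σp) (i i' : ℕ → Fin m) (n : ℕ)
    (h : ∀ t < n, i t = i' t) : cumT ω i n = cumT ω i' n := by
  induction n with
  | zero => rfl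
  | succ n ih =>
    have : pre i n = pre i' n := by
      simp only [pre]
      congr 1
      funext t
      exact h _ t.2
    rw [cumT, cumT, ih (fun t ht => h t (by omega)), this]

lemma dist_piMap {d m : ℕ} {σm σp : ℝ} (hσ0 : 0 < σm) (hp0 : 0 < σp) (hσ2 : σp < 1)
    (a : Fin m → E d) (A : ℝ) (hA : ∀ j, ‖a j‖ ≤ A) (ω : Omega d m σm σp) {k : ℕ}
    (w : Fin k → Fin m) (i i' : ℕ → Fin m) (hi : i ∈ cyl w) (hi' : i' ∈ cyl w) :
    dist (piMap a ω i) (piMap a ω i') ≤ 2 * A * (1 - σp)⁻¹ * wordR ω w := by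
  have h1 := tail_bound hσ0 hp0 hσ2 a A hA ω i k
  have h2 := tail_bound hσ0 hp0 hσ2 a A hA ω i' k
  rw [cumR_eq_wordR ω w i hi] at h1
  rw [cumR_eq_wordR ω w i' hi'] at h2
  have e : ∀ t < k, i t = i' t := fun t ht => (hi ⟨t, ht⟩).trans (hi' ⟨t, ht⟩).symm
  have s1 : Summable (fun n => cumT ω i n (a (i n))) :=
    (tail_bound hσ0 hp0 hσ2 a A hA ω i 0).1
  have s2 : Summable (fun n => cumT ω i' n (a (i' n))) :=
    (tail_bound hσ0 hp0 hσ2 a A hA ω i' 0).1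
  have e2 : ∑ n ∈ Finset.range k, cumT ω i n (a (i n))
      = ∑ n ∈ Finset.range k, cumT ω i' n (a (i' n)) := by
    refine Finset.sum_congr rfl fun n hn => ?_
    rw [Finset.mem_range] at hn
    rw [cumT_congr ω i i' n (fun t ht => e t (ht.trans hn)), e n hn]
  rw [piMap, piMap, ← s1.sum_add_tsum_nat_add k, ← s2.sum_add_tsum_nat_add k, e2, dist_add_left,
    dist_eq_norm]
  refine (norm_sub_le _ _).trans ?_
  linarith [h1.2, h2.2]

lemma wordR_bounds {d m : ℕ} {σm σp : ℝ} (hσ0 : 0 < σm) (ω : Omega d m σm σp) {k : ℕ}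
    (w : Fin k → Fin m) : 0 ≤ wordR ω w ∧ wordR ω w ≤ σp ^ k := by
  have h0 : ∀ j : Fin k, 0 ≤ ((ω ⟨j.1, fun t => w (Fin.castLE j.2 t)⟩).1 : ℝ) :=
    fun j => (hσ0.trans (ω ⟨j.1, fun t => w (Fin.castLE j.2 t)⟩).1.2.1).le
  refine ⟨Finset.prod_nonneg fun j _ => h0 j, ?_⟩
  calc wordR ω w ≤ ∏ j : Fin k, σp := Finset.prod_le_prod (fun j _ => h0 j)
        (fun j _ => (ω ⟨j.1, fun t => w (Fin.castLE j.2 t)⟩).1.2.2.le)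
    _ = σp ^ k := by simp

lemma hausdorff_bound {d m : ℕ} {σm σp : ℝ} (hσ0 : 0 < σm) (hp0 : 0 < σp) (hσ2 : σp < 1)
    (a : Fin m → E d) (A : ℝ) (hA : ∀ j, ‖a j‖ ≤ A) (hA0 : 0 ≤ A) (s : ℝ) (hs0 : 0 < s)
    (ω : Omega d m σm σp)
    (hω : liminf (fun k : ℕ => ∑ w : Fin k → Fin m, ENNReal.ofReal (wordR ω w ^ s)) atTop < ⊤) :
    μH[s] (Fset a ω) < ⊤ := by
  set C : ℝ := 2 * A * (1 - σp)⁻¹ with hC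
  have hC0 : 0 ≤ C := mul_nonneg (by positivity) (inv_nonneg.2 (by linarith))
  have hdiam : ∀ (k : ℕ) (w : Fin k → Fin m),
      Metric.ediam (piMap a ω '' cyl w) ≤ ENNReal.ofReal (C * wordR ω w) := by
    intro k w
    refine Metric.ediam_le ?_
    rintro _ ⟨i, hi, rfl⟩ _ ⟨i', hi', rfl⟩
    rw [edist_dist]
    exact ENNReal.ofReal_le_ofReal (dist_piMap hσ0 hp0 hσ2 a A hA ω w i i' hi hi')
  have key := Measure.hausdorffMeasure_le_liminf_sum (β := ℕ) (ι := fun k => (Fin k → Fin m)) s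
    (Fset a ω) (l := atTop) (fun k => ENNReal.ofReal (C * σp ^ k)) ?_
    (fun k w => piMap a ω '' cyl w) ?_ ?_
  · refine key.trans_lt ?_
    refine lt_of_le_of_lt (b := liminf (fun k : ℕ => ENNReal.ofReal (C ^ s) *
      ∑ w : Fin k → Fin m, ENNReal.ofReal (wordR ω w ^ s)) atTop) ?_ ?_
    · refine liminf_le_liminf (Eventually.of_forall fun k => ?_)
      rw [Finset.mul_sum]
      refine Finset.sum_le_sum fun w _ => ?_
      have hw := (wordR_bounds hσ0 ω w).1
      calc _ ≤ (ENNReal.ofReal (C * wordR ω w)) ^ s := ENNReal.rpow_le_rpow (hdiam k w) hs0.le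
        _ = _ := by
          rw [ENNReal.ofReal_rpow_of_nonneg (mul_nonneg hC0 hw) hs0.le,
            Real.mul_rpow hC0 hw, ENNReal.ofReal_mul (Real.rpow_nonneg hC0 s)]
    · rw [ENNReal.liminf_const_mul_of_ne_top ENNReal.ofReal_ne_top]
      exact ENNReal.mul_lt_top ENNReal.ofReal_lt_top hω
  · have : Tendsto (fun k : ℕ => C * σp ^ k) atTop (𝓝 (C * 0)) :=
      (tendsto_pow_atTop_nhds_zero_of_lt_one hp0.le hσ2).const_mul C
    simpa using ENNReal.tendsto_ofReal this
  · refine Eventually.of_forall fun k w => (hdiam k w).trans (ENNReal.ofReal_le_ofReal ?_)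
    exact mul_le_mul_of_nonneg_left (wordR_bounds hσ0 ω w).2 hC0
  · refine Eventually.of_forall fun k => ?_
    rintro _ ⟨i, rfl⟩
    exact Set.mem_iUnion.2 ⟨fun t => i t.1, i, fun t => rfl, rfl⟩

lemma isProb_unif {σm σp : ℝ} (hlt : σm < σp) : IsProbabilityMeasure (unifSub σm σp) := by
  constructor
  rw [unifSub, Measure.smul_apply, comap_subtype_coe_apply measurableSet_Ioo]
  simp only [Set.image_univ, Subtype.range_coe, Real.volume_Ioo, smul_eq_mul]
  exact ENNReal.inv_mul_cancel (by simpa using hlt) ENNReal.ofReal_ne_top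

lemma lintegral_label {d m : ℕ} {σm σp : ℝ} (hσ0 : 0 < σm) (hlt : σm < σp) (hm : 2 ≤ m)
    (θ : Measure (Od d)) (hθ1 : IsProbabilityMeasure θ) (s : ℝ)
    (hs : ((m : ℝ) / (σp - σm)) * (∫ r in σm..σp, r ^ s) = 1) :
    ∫⁻ x, ENNReal.ofReal ((x.1 : ℝ) ^ s) ∂(labelM σm σp θ) = (m : ℝ≥0∞)⁻¹ := by
  have := isProb_unif hlt
  have hm0 : (0 : ℝ) < m := by exact_mod_cast (by omega : 0 < m)
  have hd : 0 < σp - σm := by linarith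
  have hmeas : Measurable fun r : ↥(Set.Ioo σm σp) => ENNReal.ofReal ((r : ℝ) ^ s) := by fun_prop
  have hint : IntegrableOn (fun r : ℝ => r ^ s) (Set.Ioc σm σp) := by
    refine (ContinuousOn.integrableOn_Icc ?_).mono_set Set.Ioc_subset_Icc_self
    exact fun x hx => (Real.continuousAt_rpow_const x s
      (Or.inl (hσ0.trans_le hx.1).ne')).continuousWithinAt
  have h1 : ∫⁻ r : ↥(Set.Ioo σm σp), ENNReal.ofReal ((r : ℝ) ^ s)
      ∂((volume : Measure ℝ).comap Subtype.val) = ENNReal.ofReal (∫ r in σm..σp, r ^ s) := by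
    rw [lintegral_subtype_comap measurableSet_Ioo (fun r : ℝ => ENNReal.ofReal (r ^ s)),
      intervalIntegral.integral_of_le hlt.le, ofReal_integral_eq_lintegral_ofReal hint,
      restrict_Ioo_eq_restrict_Ioc]
    exact (ae_restrict_iff' measurableSet_Ioc).2 (Eventually.of_forall fun r hr =>
      Real.rpow_nonneg (hσ0.trans hr.1).le s)
  have h2 : (∫ r in σm..σp, r ^ s) = (σp - σm) * (m : ℝ)⁻¹ := by
    field_simp at hs ⊢
    linarith
  rw [labelM, lintegral_prod _ (by fun_prop)]
  simp only [lintegral_const, measure_univ, mul_one]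
  rw [unifSub, lintegral_smul_measure, h1, h2, ENNReal.ofReal_mul hd.le, smul_eq_mul, ← mul_assoc,
    ENNReal.inv_mul_cancel (by simpa using hlt) ENNReal.ofReal_ne_top, one_mul,
    ENNReal.ofReal_inv_of_pos hm0, ENNReal.ofReal_natCast]

lemma isProb_label {d : ℕ} {σm σp : ℝ} (hlt : σm < σp)
    (θ : Measure (Od d)) (hθ1 : IsProbabilityMeasure θ) :
    IsProbabilityMeasure (labelM σm σp θ) := by
  have := isProb_unif hlt
  unfold labelM
  infer_instance

lemma lintegral_wordR {d m : ℕ} {σm σp : ℝ} (hσ0 : 0 < σm) (hlt : σm < σp) (hm : 2 ≤ m)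
    (θ : Measure (Od d)) (hθ1 : IsProbabilityMeasure θ)
    (P : Measure (Omega d m σm σp)) (hP2 : IsProductLaw θ P) (s : ℝ)
    (hs : ((m : ℝ) / (σp - σm)) * (∫ r in σm..σp, r ^ s) = 1) {k : ℕ} (w : Fin k → Fin m) :
    ∫⁻ ω, ENNReal.ofReal (wordR ω w ^ s) ∂P = ((m : ℝ≥0∞)⁻¹) ^ k := by
  haveI := isProb_label hlt θ hθ1
  have hP : P = Measure.infinitePi (fun _ : JW m => labelM σm σp θ) := by
    refine Measure.eq_infinitePi _ fun S A hA => ?_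
    exact hP2 S A hA
  have hmeas : Measurable fun x : Label d σm σp => ENNReal.ofReal ((x.1 : ℝ) ^ s) := by fun_prop
  have hind : ProbabilityTheory.iIndepFun
      (fun (v : JW m) (ω : Omega d m σm σp) => ENNReal.ofReal (((ω v).1 : ℝ) ^ s)) P := by
    rw [hP]
    exact ProbabilityTheory.iIndepFun_infinitePi (fun _ => hmeas)
  let g : Fin k → JW m := fun j => ⟨j.1, fun t => w (Fin.castLE j.2 t)⟩
  have hg : Function.Injective g := fun j j' h => Fin.ext (congrArg Sigma.fst h)
  have hind' := hind.precomp hg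
  have e : ∀ ω : Omega d m σm σp, ENNReal.ofReal (wordR ω w ^ s)
      = ∏ j : Fin k, ENNReal.ofReal (((ω (g j)).1 : ℝ) ^ s) := by
    intro ω
    have h0 : ∀ j : Fin k, 0 ≤ ((ω (g j)).1 : ℝ) := fun j => (hσ0.trans (ω (g j)).1.2.1).le
    rw [← ENNReal.ofReal_prod_of_nonneg (fun j _ => Real.rpow_nonneg (h0 j) s),
      Real.finsetProd_rpow _ _ (fun j _ => h0 j)]
    rfl
  simp_rw [e]
  rw [ProbabilityTheory.lintegral_prod_eq_prod_lintegral_of_indepFun Finset.univ _ hind'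
    (fun j => hmeas.comp (measurable_pi_apply _))]
  have : ∀ v : JW m, ∫⁻ ω, ENNReal.ofReal (((ω v).1 : ℝ) ^ s) ∂P = (m : ℝ≥0∞)⁻¹ := by
    intro v
    have hmap := Measure.infinitePi_map_eval (fun _ : JW m => labelM σm σp θ) v
    rw [← hP] at hmap
    have h3 := lintegral_map (μ := P) hmeas (measurable_pi_apply v)
    rw [← lintegral_label hσ0 hlt hm θ hθ1 s hs, ← h3]
    congr 1
  simp [this]

/-- For `ℙ`-almost every `ω`, the `s`-dimensional Hausdorff measure of `F(ω)` is finite. -/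
theorem stmt11 (d m : ℕ) (hd : 1 ≤ d) (hm : 2 ≤ m)
    (σm σp : ℝ) (hσ0 : 0 < σm) (hσ1 : σm ≤ σp) (hσ2 : σp < 1)
    (a : Fin m → E d) (ha : Function.Injective a)
    (θ : Measure (Od d)) (hθ1 : IsProbabilityMeasure θ) (hθ2 : θ.IsMulLeftInvariant)
    (P : Measure (Omega d m σm σp)) (hP1 : IsProbabilityMeasure P)
    (hP2 : IsProductLaw θ P)
    (s : ℝ) (hs0 : 0 < s)
    (hs : ((m : ℝ) / (σp - σm)) * (∫ r in σm..σp, r ^ s) = 1) :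
    ∀ᵐ ω ∂P, μH[s] (Fset a ω) < ⊤ := by
  have hlt : σm < σp := by
    rcases hσ1.lt_or_eq with h | h
    · exact h
    · subst h; simp at hs
  have hmeas : ∀ k : ℕ, Measurable (fun ω : Omega d m σm σp =>
      ∑ w : Fin k → Fin m, ENNReal.ofReal (wordR ω w ^ s)) := by
    intro k
    unfold wordR
    fun_prop
  have hE : ∀ k : ℕ, ∫⁻ ω, ∑ w : Fin k → Fin m, ENNReal.ofReal (wordR ω w ^ s) ∂P = 1 := by
    intro k
    rw [lintegral_finsetSum _ (fun w _ => by unfold wordR; fun_prop)]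
    simp_rw [lintegral_wordR hσ0 hlt hm θ hθ1 P hP2 s hs]
    have hm0 : (m : ℝ≥0∞) ≠ 0 := by simp; omega
    simp [← mul_pow, ENNReal.mul_inv_cancel hm0]
  have hF := lintegral_liminf_le (μ := P) (u := atTop) hmeas
  simp_rw [hE] at hF
  rw [liminf_const] at hF
  have hae := ae_lt_top (Measurable.liminf hmeas) (hF.trans_lt ENNReal.one_lt_top).ne
  filter_upwards [hae] with ω hω
  exact hausdorff_bound hσ0 (hσ0.trans hlt) hσ2 a (∑ j, ‖a j‖)
    (fun j => Finset.single_le_sum (f := fun j => ‖a j‖) (fun j _ => norm_nonneg _)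
      (Finset.mem_univ j)) (Finset.sum_nonneg fun j _ => norm_nonneg _) s hs0 ω hω
end

section
/- There exists a family (μ^ω)_{ω∈Ω} of finite Borel measures on J_∞ (with the product topology) such that: (a) for every i ∈ J the map ω ↦ μ^ω([i]) is measurable; (b) for ℙ-almost every ω, 0 < μ^ω(J_∞) < ∞; (c) for every k ≥ 1 and every i ∈ J_k, the conditional expectation E(μ^ω([i]) | 𝓕_k) equals (𝐫_i^ω)^s ℙ-almost surely; and (d) for every k ≥ 1, E(∑_{i ∈ J_k} μ^ω([i])) = 1. -/
open MeasureTheory Filter Topology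
open scoped ENNReal

open ProbabilityTheory

theorem isClopen_cyl {m k : ℕ} (w : Fin k → Fin m) : IsClopen (cyl w) := by
  have : cyl w = ⋂ t : Fin k, (fun j : ℕ → Fin m => j t.1) ⁻¹' {w t} := by
    ext j; simp [cyl]
  rw [this]
  exact isClopen_iInter_of_finite fun t =>
    (isClopen_discrete {w t}).preimage (continuous_apply t.1)

theorem exists_lim_measure {m : ℕ} (ν : ℕ → FiniteMeasure (ℕ → Fin m))
    (L : ∀ k, (Fin k → Fin m) → ℝ)
    (h : ∀ k w, Tendsto (fun n => (ν n : Measure (ℕ → Fin m)).real (cyl w)) atTop (𝓝 (L k w))) :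
    ∃ μ : FiniteMeasure (ℕ → Fin m), ∀ k w, (μ : Measure (ℕ → Fin m)).real (cyl w) = L k w := by
  have hu : cyl (Fin.elim0 : Fin 0 → Fin m) = Set.univ := by
    ext j; simp [cyl]
  have h0 := h 0 Fin.elim0
  rw [hu] at h0
  have hb : ∀ᶠ n in atTop, ν n ∈ {μ : FiniteMeasure (ℕ → Fin m) | μ.mass ≤ Real.toNNReal (L 0 Fin.elim0 + 1)} := by
    filter_upwards [h0.eventually (gt_mem_nhds (lt_add_one _))] with n hn
    have : ((ν n).mass : ℝ) ≤ L 0 Fin.elim0 + 1 := hn.le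
    exact NNReal.le_toNNReal_of_coe_le this
  have hc := isCompact_setOfPred_finiteMeasure_le_of_compactSpace (ℕ → Fin m) (Real.toNNReal (L 0 Fin.elim0 + 1))
  obtain ⟨μ, -, hμ⟩ := hc.ultrafilter_le_nhds' ((hyperfilter ℕ).map ν)
    (hb.filter_mono (Nat.hyperfilter_le_atTop))
  refine ⟨μ, fun k w => ?_⟩
  have ht : Tendsto ν (hyperfilter ℕ : Filter ℕ) (𝓝 μ) := hμ
  rw [FiniteMeasure.tendsto_iff_forall_integral_tendsto] at ht
  have hcl := isClopen_cyl w
  let f : BoundedContinuousFunction (ℕ → Fin m) ℝ :=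
    BoundedContinuousFunction.indicator (cyl w) hcl
  have h1 := ht f
  have h2 : ∀ ρ : FiniteMeasure (ℕ → Fin m), ∫ x, f x ∂(ρ : Measure (ℕ → Fin m)) = (ρ : Measure (ℕ → Fin m)).real (cyl w) := by
    intro ρ
    have : ∀ x, f x = (cyl w).indicator (fun _ => (1:ℝ)) x := fun x => rfl
    simp_rw [this]
    rw [integral_indicator hcl.isOpen.measurableSet]; simp [Measure.real]
  simp_rw [h2] at h1
  exact tendsto_nhds_unique h1 ((h k w).mono_left Nat.hyperfilter_le_atTop)

section tree

variable {d m : ℕ} {σm σp : ℝ}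

noncomputable def al (s : ℝ) (ω : Omega d m σm σp) (u : JW m) : ℝ := ((ω u).1 : ℝ) ^ s

noncomputable def Wt (s : ℝ) (ω : Omega d m σm σp) {n : ℕ} (v : Fin n → Fin m) : ℝ := wordR ω v ^ s

def ext {m k n : ℕ} (w : Fin k → Fin m) (v : Fin n → Fin m) : Prop :=
  ∀ t : Fin k, ∀ h : t.1 < n, v ⟨t.1, h⟩ = w t

open Classical in
noncomputable def Y (s : ℝ) {k : ℕ} (w : Fin k → Fin m) (n : ℕ) (ω : Omega d m σm σp) : ℝ :=
  ∑ v : Fin n → Fin m, if ext w v then Wt s ω v else 0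

theorem al_pos (h0 : 0 < σm) (s : ℝ) (ω : Omega d m σm σp) (u : JW m) : 0 < al s ω u :=
  Real.rpow_pos_of_pos (h0.trans (ω u).1.2.1) _

theorem al_ge (h0 : 0 < σm) {s : ℝ} (hs : 0 < s) (ω : Omega d m σm σp) (u : JW m) :
    σm ^ s ≤ al s ω u := Real.rpow_le_rpow h0.le (ω u).1.2.1.le hs.le

theorem al_le (h0 : 0 < σm) {s : ℝ} (hs : 0 < s) (ω : Omega d m σm σp) (u : JW m) :
    al s ω u ≤ σp ^ s := Real.rpow_le_rpow (h0.trans (ω u).1.2.1).le (ω u).1.2.2.le hs.le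

theorem al_le_one (h0 : 0 < σm) (h1 : σp < 1) {s : ℝ} (hs : 0 < s) (ω : Omega d m σm σp)
    (u : JW m) : al s ω u ≤ 1 :=
  Real.rpow_le_one (h0.trans (ω u).1.2.1).le ((ω u).1.2.2.trans h1).le hs.le

theorem Wt_eq_prod (h0 : 0 < σm) (s : ℝ) (ω : Omega d m σm σp) {n : ℕ} (v : Fin n → Fin m) :
    Wt s ω v = ∏ j : Fin n, al s ω ⟨j.1, fun t => v (Fin.castLE j.2 t)⟩ := by
  unfold Wt wordR al
  rw [Real.finsetProd_rpow]
  intro i _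
  exact (h0.trans (ω _).1.2.1).le

theorem Wt_pos (h0 : 0 < σm) (s : ℝ) (ω : Omega d m σm σp) {n : ℕ} (v : Fin n → Fin m) :
    0 < Wt s ω v := by
  rw [Wt_eq_prod h0]; exact Finset.prod_pos fun _ _ => al_pos h0 _ _ _

theorem Wt_le_one (h0 : 0 < σm) (h1 : σp < 1) {s : ℝ} (hs : 0 < s)
    (ω : Omega d m σm σp) {n : ℕ} (v : Fin n → Fin m) :
    Wt s ω v ≤ 1 := by
  rw [Wt_eq_prod h0]
  exact Finset.prod_le_one (fun _ _ => (al_pos h0 _ _ _).le) fun _ _ => al_le_one h0 h1 hs _ _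

theorem Wt_snoc (h0 : 0 < σm) (s : ℝ) (ω : Omega d m σm σp) {n : ℕ} (v : Fin n → Fin m)
    (j : Fin m) :
    Wt s ω (Fin.snoc v j : Fin (n+1) → Fin m) =
      Wt s ω v * al s ω ⟨n, (Fin.snoc v j : Fin (n+1) → Fin m)⟩ := by
  rw [Wt_eq_prod h0, Wt_eq_prod h0, Fin.prod_univ_castSucc]
  congr 1
  refine Finset.prod_congr rfl fun i _ => ?_
  congr 2
  funext t
  have : (Fin.castLE (Fin.castSucc i).2 t : Fin (n+1)) = Fin.castSucc (Fin.castLE i.2 t) := by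
    ext; simp
  exact (congrArg _ this).trans (Fin.snoc_castSucc (α := fun _ => Fin m) j v (Fin.castLE i.2 t))

theorem sum_snoc {n : ℕ} (f : (Fin (n+1) → Fin m) → ℝ) :
    ∑ u, f u = ∑ v : Fin n → Fin m, ∑ j : Fin m, f (Fin.snoc v j) := by
  rw [Finset.sum_comm, ← Fintype.sum_prod_type' (f := fun (j : Fin m) (v : Fin n → Fin m) => f (Fin.snoc v j))]
  exact (Fintype.sum_equiv (Fin.snocEquiv (fun _ => Fin m)) _ _ (fun _ => rfl)).symm

theorem ext_snoc {k n : ℕ} (hk : k ≤ n) (w : Fin k → Fin m) (v : Fin n → Fin m) (j : Fin m) :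
    ext w (Fin.snoc v j : Fin (n+1) → Fin m) ↔ ext w v := by
  have : ∀ t : Fin k, ∀ h : t.1 < n+1, (Fin.snoc v j : Fin (n+1) → Fin m) ⟨t.1, h⟩ = v ⟨t.1, t.2.trans_le hk⟩ := by
    intro t h
    exact Fin.snoc_castSucc (α := fun _ => Fin m) j v ⟨t.1, t.2.trans_le hk⟩
  constructor
  · intro H t h
    rw [← H t (h.trans (Nat.lt_succ_self n)), this]
  · intro H t h
    rw [this]; exact H t _

theorem ext_self {k : ℕ} (w v : Fin k → Fin m) : ext w v ↔ v = w := by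
  constructor
  · intro H; funext t; exact H t t.2
  · rintro rfl t h; rfl

theorem Y_self (s : ℝ) {k : ℕ} (w : Fin k → Fin m) (ω : Omega d m σm σp) :
    Y s w k ω = Wt s ω w := by
  simp [Y, ext_self]

theorem Y_nonneg (h0 : 0 < σm) (s : ℝ) {k : ℕ} (w : Fin k → Fin m) (n : ℕ) (ω : Omega d m σm σp) :
    0 ≤ Y s w n ω := by
  refine Finset.sum_nonneg fun v _ => ?_
  split_ifs
  exacts [(Wt_pos h0 s ω v).le, le_rfl]

/-- the total mass -/
noncomputable def M (s : ℝ) (n : ℕ) (ω : Omega d m σm σp) : ℝ := ∑ v : Fin n → Fin m, Wt s ω v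

theorem Y_le_M (h0 : 0 < σm) (s : ℝ) {k : ℕ} (w : Fin k → Fin m) (n : ℕ) (ω : Omega d m σm σp) :
    Y s w n ω ≤ M s n ω := by
  refine Finset.sum_le_sum fun v _ => ?_
  split_ifs
  exacts [le_rfl, (Wt_pos h0 s ω v).le]

theorem Y_zero (s : ℝ) (w : Fin 0 → Fin m) (n : ℕ) (ω : Omega d m σm σp) :
    Y s w n ω = M s n ω := by
  unfold Y M
  refine Finset.sum_congr rfl fun v _ => ?_
  rw [if_pos]
  intro t; exact t.elim0

/-- approximating measures -/
noncomputable def nu (z : Fin m) (s : ℝ) (n : ℕ) (ω : Omega d m σm σp) : Measure (ℕ → Fin m) :=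
  ∑ v : Fin n → Fin m, ENNReal.ofReal (Wt s ω v) •
    Measure.dirac (fun t => if h : t < n then v ⟨t, h⟩ else z)

instance nu_finite (z : Fin m) (s : ℝ) (n : ℕ) (ω : Omega d m σm σp) : IsFiniteMeasure (nu z s n ω) := by
  unfold nu
  constructor
  simp only [Measure.coe_finsetSum, Finset.sum_apply, Measure.smul_apply, smul_eq_mul]
  simp [ENNReal.sum_lt_top]

theorem nu_cyl (h0 : 0 < σm) (z : Fin m) (s : ℝ) {k n : ℕ} (hk : k ≤ n) (w : Fin k → Fin m)
    (ω : Omega d m σm σp) : (nu z s n ω).real (cyl w) = Y s w n ω := by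
  unfold nu Y
  simp only [Measure.real, Measure.coe_finsetSum, Finset.sum_apply, Measure.smul_apply, smul_eq_mul]
  rw [ENNReal.toReal_sum]
  · refine Finset.sum_congr rfl fun v _ => ?_
    rw [Measure.dirac_apply' _ (isClopen_cyl w).isOpen.measurableSet]
    have : ((fun t => if h : t < n then v ⟨t, h⟩ else z) ∈ cyl w) ↔ ext w v := by
      unfold cyl ext
      refine forall_congr' fun t => ?_
      have := t.2.trans_le hk
      simp [this]
    by_cases h : ext w v
    · rw [Set.indicator_of_mem (this.2 h), if_pos h]
      simp [(Wt_pos h0 s ω v).le]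
    · rw [Set.indicator_of_notMem (fun h' => h (this.1 h')), if_neg h]
      simp
  · intro v _
    exact ENNReal.mul_ne_top ENNReal.ofReal_ne_top (measure_ne_top _ _)

end tree

section prob

variable {d m : ℕ} {σm σp : ℝ}

/-- sigma-algebra generated by coordinates in `S` -/
abbrev GS (d m : ℕ) (σm σp : ℝ) (S : Set (JW m)) : MeasurableSpace (Omega d m σm σp) :=
  ⨆ u ∈ S, MeasurableSpace.comap (fun ω : Omega d m σm σp => ω u) inferInstance

theorem GS_le (S : Set (JW m)) : GS d m σm σp S ≤ (inferInstance : MeasurableSpace (Omega d m σm σp)) :=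
  iSup₂_le fun u _ => (measurable_pi_apply u).comap_le

theorem GS_mono {S T : Set (JW m)} (h : S ⊆ T) : GS d m σm σp S ≤ GS d m σm σp T :=
  biSup_mono h

theorem Fk_eq (k : ℕ) : Fk d m σm σp k = GS d m σm σp {u | u.1 + 1 ≤ k} := by
  unfold Fk GS
  rw [iSup_subtype]
  rfl

theorem al_meas (s : ℝ) {S : Set (JW m)} {u : JW m} (hu : u ∈ S) :
    Measurable[GS d m σm σp S] (fun ω : Omega d m σm σp => al s ω u) := by
  have h1 : Measurable[GS d m σm σp S] (fun ω : Omega d m σm σp => ω u) := by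
    rw [measurable_iff_comap_le]
    exact le_iSup₂_of_le u hu le_rfl
  have h2 : Measurable (fun x : Label d σm σp => (x.1 : ℝ) ^ s) := by fun_prop
  exact h2.comp h1

theorem Wt_meas (h0 : 0 < σm) (s : ℝ) {n : ℕ} (v : Fin n → Fin m) {S : Set (JW m)}
    (hS : ∀ u : JW m, u.1 + 1 ≤ n → u ∈ S) :
    Measurable[GS d m σm σp S] (fun ω : Omega d m σm σp => Wt s ω v) := by
  simp_rw [Wt_eq_prod h0]
  refine Finset.measurable_fun_prod _ fun i _ => ?_
  exact al_meas s (hS _ i.2)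

theorem Wt_meas' (h0 : 0 < σm) (s : ℝ) {n : ℕ} (v : Fin n → Fin m)  :
    Measurable (fun ω : Omega d m σm σp => Wt s ω v) :=
  (Wt_meas h0 s v (S := Set.univ) (fun _ _ => trivial)).mono (GS_le _) le_rfl

theorem al_meas' (s : ℝ) (u : JW m)  :
    Measurable (fun ω : Omega d m σm σp => al s ω u) :=
  (al_meas s (S := Set.univ) trivial).mono (GS_le _) le_rfl

theorem Y_meas (h0 : 0 < σm) (s : ℝ) {k : ℕ} (w : Fin k → Fin m) (n : ℕ) :
    Measurable[Fk d m σm σp n] (fun ω : Omega d m σm σp => Y s w n ω) := by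
  rw [Fk_eq]
  unfold Y
  refine Finset.measurable_fun_sum _ fun v _ => ?_
  split_ifs
  · exact Wt_meas h0 s v (fun u hu => hu)
  · exact measurable_const

theorem Fk_le (n : ℕ) : Fk d m σm σp n ≤ (inferInstance : MeasurableSpace (Omega d m σm σp)) := by
  rw [Fk_eq]; exact GS_le _

theorem Y_meas' (h0 : 0 < σm) (s : ℝ) {k : ℕ} (w : Fin k → Fin m) (n : ℕ) :
    Measurable (fun ω : Omega d m σm σp => Y s w n ω) :=
  (Y_meas h0 s w n).mono (Fk_le n) le_rfl

variable {P : Measure (Omega d m σm σp)} [IsProbabilityMeasure P]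

theorem bint {f : Omega d m σm σp → ℝ} (hf : Measurable f) (C : ℝ) (h : ∀ ω, |f ω| ≤ C) :
    Integrable f P :=
  Integrable.of_bound hf.aestronglyMeasurable C (ae_of_all _ h)

theorem indep_GS (hI : iIndepFun (fun (u : JW m) (ω : Omega d m σm σp) => ω u) P)
    {S T : Set (JW m)} (h : Disjoint S T) :
    Indep (GS d m σm σp S) (GS d m σm σp T) P :=
  indep_iSup_of_disjoint (fun u => (measurable_pi_apply u).comap_le) hI h

theorem key (h0 : 0 < σm) (h1 : σp < 1) {s : ℝ} (hs : 0 < s)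
    (hI : iIndepFun (fun (u : JW m) (ω : Omega d m σm σp) => ω u) P)
    (hE : ∀ u : JW m, ∫ ω, al s ω u ∂P = 1 / m) {S : Set (JW m)} {u : JW m} (hu : u ∉ S)
    {Z : Omega d m σm σp → ℝ} (hZ : Measurable[GS d m σm σp S] Z) :
    ∫ ω, Z ω * al s ω u ∂P = (∫ ω, Z ω ∂P) / m := by
  have hind : IndepFun Z (fun ω => al s ω u) P := by
    rw [IndepFun_iff_Indep]
    have := indep_GS hI (S := S) (T := {u}) (by simpa using hu)
    exact indep_of_indep_of_le_left (indep_of_indep_of_le_right this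
      (measurable_iff_comap_le.1 (al_meas s (Set.mem_singleton _)))) (measurable_iff_comap_le.1 hZ)
  have := hind.integral_fun_mul_eq_mul_integral (hZ.mono (GS_le _) le_rfl).aestronglyMeasurable
    (al_meas' s u).aestronglyMeasurable
  rw [this, hE]; ring

theorem Wb (h0 : 0 < σm) (h1 : σp < 1) {s : ℝ} (hs : 0 < s)
    (ω : Omega d m σm σp) {n : ℕ} (v : Fin n → Fin m) : |Wt s ω v| ≤ 1 := by
  rw [abs_of_pos (Wt_pos h0 s ω v)]; exact Wt_le_one h0 h1 hs ω v

theorem ab (h0 : 0 < σm) (h1 : σp < 1) {s : ℝ} (hs : 0 < s)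
    (ω : Omega d m σm σp) (u : JW m) : |al s ω u| ≤ 1 := by
  rw [abs_of_pos (al_pos h0 s ω u)]; exact al_le_one h0 h1 hs ω u

theorem mulb {x y : ℝ} (hx : |x| ≤ 1) (hy : |y| ≤ 1) : |x * y| ≤ 1 := by
  rw [abs_mul]; exact mul_le_one₀ hx (abs_nonneg _) hy

theorem D_succ (h0 : 0 < σm) (h1 : σp < 1) {s : ℝ} (hs : 0 < s) (hm : 0 < m)
    (hI : iIndepFun (fun (u : JW m) (ω : Omega d m σm σp) => ω u) P)
    (hE : ∀ u : JW m, ∫ ω, al s ω u ∂P = 1 / m) (n : ℕ) :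
    ∑ v : Fin n → Fin m, ∫ ω, Wt s ω v * Wt s ω v ∂P ≤ (σp ^ s) ^ n := by
  induction n with
  | zero => simp [Wt, wordR]
  | succ n ih =>
    rw [sum_snoc]
    have hmm : (0:ℝ) < m := by exact_mod_cast hm
    have h2 : ∀ (v : Fin n → Fin m) (j : Fin m),
        ∫ ω, Wt s ω (Fin.snoc v j : Fin (n+1) → Fin m) * Wt s ω (Fin.snoc v j : Fin (n+1) → Fin m) ∂P
        ≤ σp ^ s * ((∫ ω, Wt s ω v * Wt s ω v ∂P) / m) := by
      intro v j
      rw [← key h0 h1 hs hI hE (S := {u | u.1 + 1 ≤ n}) (u := ⟨n, (Fin.snoc v j : Fin (n+1) → Fin m)⟩)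
        (Z := fun ω => Wt s ω v * Wt s ω v) (by simp) (((Wt_meas h0 s v (fun u hu => hu)).mul (Wt_meas h0 s v (fun u hu => hu)))),
        ← integral_const_mul]
      refine integral_mono (bint ((Wt_meas' h0 s _).mul (Wt_meas' h0 s _)) 1 fun ω =>
        mulb (Wb h0 h1 hs _ _) (Wb h0 h1 hs _ _)) ((bint (((Wt_meas' h0 s _).mul (Wt_meas' h0 s _)).mul (al_meas' s _)) 1 fun ω =>
        mulb (mulb (Wb h0 h1 hs _ _) (Wb h0 h1 hs _ _)) (ab h0 h1 hs _ _)).const_mul _) fun ω => ?_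
      simp only [Wt_snoc h0]
      have ha := al_le h0 hs ω ⟨n, (Fin.snoc v j : Fin (n+1) → Fin m)⟩
      have hp := al_pos h0 s ω ⟨n, (Fin.snoc v j : Fin (n+1) → Fin m)⟩
      have hw := Wt_pos h0 s ω v
      have : 0 ≤ (Wt s ω v * Wt s ω v * al s ω ⟨n, (Fin.snoc v j : Fin (n+1) → Fin m)⟩) := by positivity
      nlinarith [mul_le_mul_of_nonneg_left ha this]
    calc _ ≤ ∑ v : Fin n → Fin m, ∑ j : Fin m, σp ^ s * ((∫ ω, Wt s ω v * Wt s ω v ∂P) / m) :=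
          Finset.sum_le_sum fun v _ => Finset.sum_le_sum fun j _ => h2 v j
      _ = σp ^ s * ∑ v : Fin n → Fin m, ∫ ω, Wt s ω v * Wt s ω v ∂P := by
          rw [Finset.mul_sum]
          refine Finset.sum_congr rfl fun v _ => ?_
          simp; field_simp
      _ ≤ σp ^ s * (σp ^ s) ^ n := by
          refine mul_le_mul_of_nonneg_left ih ?_
          obtain ⟨ω⟩ : Nonempty (Omega d m σm σp) := P.nonempty_of_neZero
          exact (al_pos h0 s ω ⟨0, fun _ => ⟨0, hm⟩⟩).le.trans (al_le h0 hs ω _)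
      _ = _ := by ring

theorem M_sq (s : ℝ) (n : ℕ) (ω : Omega d m σm σp) :
    M s n ω ^ 2 = ∑ v : Fin n → Fin m, ∑ v' : Fin n → Fin m, Wt s ω v * Wt s ω v' := by
  rw [M, sq, Finset.sum_mul_sum]

theorem int_WW (h0 : 0 < σm) (h1 : σp < 1) {s : ℝ} (hs : 0 < s) {n : ℕ} (v v' : Fin n → Fin m) :
    Integrable (fun ω : Omega d m σm σp => Wt s ω v * Wt s ω v') P :=
  bint ((Wt_meas' h0 s _).mul (Wt_meas' h0 s _)) 1 fun ω =>
        mulb (Wb h0 h1 hs _ _) (Wb h0 h1 hs _ _)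

theorem E_M_sq (h0 : 0 < σm) (h1 : σp < 1) {s : ℝ} (hs : 0 < s) (n : ℕ) :
    ∫ ω, M s n ω ^ 2 ∂P = ∑ v : Fin n → Fin m, ∑ v' : Fin n → Fin m, ∫ ω, Wt s ω v * Wt s ω v' ∂P := by
  simp_rw [M_sq]
  rw [integral_finsetSum]
  · refine Finset.sum_congr rfl fun v _ => ?_
    rw [integral_finsetSum]
    intro v' _
    exact int_WW h0 h1 hs v v'
  · intro v _
    exact integrable_finsetSum _ fun v' _ => int_WW h0 h1 hs v v'

theorem E_M_succ (h0 : 0 < σm) (h1 : σp < 1) {s : ℝ} (hs : 0 < s) (hm : 0 < m)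
    (hI : iIndepFun (fun (u : JW m) (ω : Omega d m σm σp) => ω u) P)
    (hE : ∀ u : JW m, ∫ ω, al s ω u ∂P = 1 / m) (n : ℕ) :
    ∫ ω, M s (n+1) ω ^ 2 ∂P ≤ ∫ ω, M s n ω ^ 2 ∂P + (σp ^ s) ^ (n + 1) := by
  have hmm : (0:ℝ) < m := by exact_mod_cast hm
  refine le_trans ?_ (add_le_add_right (D_succ (P := P) h0 h1 hs hm hI hE (n+1)) _)
  rw [E_M_sq h0 h1 hs, E_M_sq h0 h1 hs]
  have hoff : ∀ (v v' : Fin n → Fin m) (j j' : Fin m),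
      ∫ ω, Wt s ω (Fin.snoc v j : Fin (n+1) → Fin m) * Wt s ω (Fin.snoc v' j' : Fin (n+1) → Fin m) ∂P
      ≤ (∫ ω, Wt s ω v * Wt s ω v' ∂P) / m / m +
        (if (Fin.snoc v j : Fin (n+1) → Fin m) = (Fin.snoc v' j' : Fin (n+1) → Fin m) then
          ∫ ω, Wt s ω (Fin.snoc v j : Fin (n+1) → Fin m) * Wt s ω (Fin.snoc v j : Fin (n+1) → Fin m) ∂P else 0) := by
    intro v v' j j'
    split_ifs with h
    · rw [h]
      have : 0 ≤ ∫ ω, Wt s ω v * Wt s ω v' ∂P :=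
        integral_nonneg fun ω => mul_nonneg (Wt_pos h0 s ω v).le (Wt_pos h0 s ω v').le
      have : 0 ≤ (∫ ω, Wt s ω v * Wt s ω v' ∂P) / m / m := by positivity
      linarith
    · rw [add_zero]
      apply le_of_eq
      rw [← key h0 h1 hs hI hE (S := {u | u.1 + 1 ≤ n}) (u := ⟨n, (Fin.snoc v j : Fin (n+1) → Fin m)⟩)
        (Z := fun ω => Wt s ω v * Wt s ω v') (by simp) (((Wt_meas h0 s v (fun u hu => hu)).mul (Wt_meas h0 s v' (fun u hu => hu)))),
        ← key h0 h1 hs hI hE (S := {u | u.1 + 1 ≤ n} ∪ {⟨n, (Fin.snoc v j : Fin (n+1) → Fin m)⟩})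
          (u := ⟨n, (Fin.snoc v' j' : Fin (n+1) → Fin m)⟩)
        (Z := fun ω => Wt s ω v * Wt s ω v' * al s ω ⟨n, (Fin.snoc v j : Fin (n+1) → Fin m)⟩)
        (by simpa using Ne.symm h) (((Wt_meas h0 s v (fun u hu => Or.inl hu)).mul
          (Wt_meas h0 s v' (fun u hu => Or.inl hu))).mul (al_meas s (Or.inr (Set.mem_singleton _))))]
      refine integral_congr_ae (ae_of_all _ fun ω => ?_)
      simp only [Wt_snoc h0, Pi.mul_apply]
      ring
  simp_rw [sum_snoc (n := n)]
  calc _ ≤ ∑ v : Fin n → Fin m, ∑ j : Fin m, ∑ v' : Fin n → Fin m, ∑ j' : Fin m,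
        ((∫ ω, Wt s ω v * Wt s ω v' ∂P) / m / m +
        (if (Fin.snoc v j : Fin (n+1) → Fin m) = (Fin.snoc v' j' : Fin (n+1) → Fin m) then
          ∫ ω, Wt s ω (Fin.snoc v j : Fin (n+1) → Fin m) * Wt s ω (Fin.snoc v j : Fin (n+1) → Fin m) ∂P else 0)) :=
        Finset.sum_le_sum fun v _ => Finset.sum_le_sum fun j _ => Finset.sum_le_sum fun v' _ =>
          Finset.sum_le_sum fun j' _ => hoff v v' j j'
    _ = _ := by
      simp_rw [Finset.sum_add_distrib]
      congr 1
      · refine Finset.sum_congr rfl fun v _ => ?_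
        simp [← Finset.mul_sum, ← Finset.sum_div]
        field_simp
      · refine Finset.sum_congr rfl fun v _ => Finset.sum_congr rfl fun j _ => ?_
        rw [← sum_snoc (fun u => if (Fin.snoc v j : Fin (n+1) → Fin m) = u then
          ∫ ω, Wt s ω (Fin.snoc v j : Fin (n+1) → Fin m) * Wt s ω (Fin.snoc v j : Fin (n+1) → Fin m) ∂P else 0)]
        simp

theorem E_M_bdd (h0 : 0 < σm) (h1 : σp < 1) {s : ℝ} (hs : 0 < s) (hm : 0 < m)
    (hI : iIndepFun (fun (u : JW m) (ω : Omega d m σm σp) => ω u) P)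
    (hE : ∀ u : JW m, ∫ ω, al s ω u ∂P = 1 / m) :
    ∃ C : ℝ, ∀ n, ∫ ω, M s n ω ^ 2 ∂P ≤ C := by
  obtain ⟨ω⟩ : Nonempty (Omega d m σm σp) := P.nonempty_of_neZero
  have hp : 0 < σp := (h0.trans (ω ⟨0, fun _ => ⟨0, hm⟩⟩).1.2.1).trans (ω ⟨0, fun _ => ⟨0, hm⟩⟩).1.2.2
  have hq0 : 0 ≤ σp ^ s := (Real.rpow_pos_of_pos hp _).le
  have hq1 : σp ^ s < 1 := Real.rpow_lt_one hp.le h1 hs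
  refine ⟨∑' i, (σp ^ s) ^ i, fun n => ?_⟩
  have : ∫ ω, M s n ω ^ 2 ∂P ≤ ∑ i ∈ Finset.range (n+1), (σp ^ s) ^ i := by
    induction n with
    | zero => simp [M, Wt, wordR]
    | succ n ih =>
      rw [Finset.sum_range_succ]
      linarith [E_M_succ (P := P) h0 h1 hs hm hI hE n]
  exact this.trans ((summable_geometric_of_lt_one hq0 hq1).sum_le_tsum _ fun i _ => by positivity)

theorem Mb (h0 : 0 < σm) (h1 : σp < 1) {s : ℝ} (hs : 0 < s) (n : ℕ) (ω : Omega d m σm σp) :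
    M s n ω ≤ (m:ℝ) ^ n := by
  refine (Finset.sum_le_sum fun v _ => Wt_le_one h0 h1 hs ω v).trans ?_
  simp

theorem Y_int (h0 : 0 < σm) (h1 : σp < 1) {s : ℝ} (hs : 0 < s) {k : ℕ} (w : Fin k → Fin m) (n : ℕ) :
    Integrable (fun ω : Omega d m σm σp => Y s w n ω) P :=
  bint (Y_meas' h0 s w n) ((m:ℝ)^n) fun ω => by
    rw [abs_of_nonneg (Y_nonneg h0 s w n ω)]
    exact (Y_le_M h0 s w n ω).trans (Mb h0 h1 hs n ω)

theorem Ysq_int (h0 : 0 < σm) (h1 : σp < 1) {s : ℝ} (hs : 0 < s) {k : ℕ} (w : Fin k → Fin m) (n : ℕ) :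
    Integrable (fun ω : Omega d m σm σp => Y s w n ω ^ 2) P :=
  bint ((Y_meas' h0 s w n).pow_const 2) (((m:ℝ)^n)^2) fun ω => by
    rw [abs_of_nonneg (sq_nonneg _)]
    exact pow_le_pow_left₀ (Y_nonneg h0 s w n ω) ((Y_le_M h0 s w n ω).trans (Mb h0 h1 hs n ω)) 2

theorem Ysq_bdd (h0 : 0 < σm) (h1 : σp < 1) {s : ℝ} (hs : 0 < s) (hm : 0 < m)
    (hI : iIndepFun (fun (u : JW m) (ω : Omega d m σm σp) => ω u) P)
    (hE : ∀ u : JW m, ∫ ω, al s ω u ∂P = 1 / m) :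
    ∃ C : ℝ, ∀ (k : ℕ) (w : Fin k → Fin m) (n : ℕ), ∫ ω, Y s w n ω ^ 2 ∂P ≤ C := by
  obtain ⟨C, hC⟩ := E_M_bdd (P := P) h0 h1 hs hm hI hE
  refine ⟨C, fun k w n => le_trans ?_ (hC n)⟩
  simp_rw [← Y_zero s (Fin.elim0 : Fin 0 → Fin m)]
  refine integral_mono (Ysq_int h0 h1 hs w n) (Ysq_int h0 h1 hs _ n) fun ω => ?_
  refine pow_le_pow_left₀ (Y_nonneg h0 s w n ω) ?_ 2
  rw [Y_zero]
  exact Y_le_M h0 s w n ω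

theorem al_condExp {s : ℝ}
    (hI : iIndepFun (fun (u : JW m) (ω : Omega d m σm σp) => ω u) P) (u : JW m) (n : ℕ)
    (hu : ¬ u.1 + 1 ≤ n) :
    P[(fun ω => al s ω u) | Fk d m σm σp n] =ᵐ[P] fun _ => ∫ ω, al s ω u ∂P := by
  have h1 : StronglyMeasurable[GS d m σm σp {u}] (fun ω : Omega d m σm σp => al s ω u) :=
    (al_meas s (Set.mem_singleton u)).stronglyMeasurable
  have h2 : Indep (GS d m σm σp {u}) (Fk d m σm σp n) P := by
    rw [Fk_eq]
    exact indep_GS hI (by simpa using hu)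
  exact condExp_indep_eq (GS_le {u}) (Fk_le n) h1 h2

theorem Y_condExp (h0 : 0 < σm) (h1 : σp < 1) {s : ℝ} (hs : 0 < s) (hm : 0 < m)
    (hI : iIndepFun (fun (u : JW m) (ω : Omega d m σm σp) => ω u) P)
    (hE : ∀ u : JW m, ∫ ω, al s ω u ∂P = 1 / m) {k n : ℕ} (hk : k ≤ n) (w : Fin k → Fin m) :
    (fun ω => Y s w n ω) =ᵐ[P] P[fun ω => Y s w (n+1) ω | Fk d m σm σp n] := by
  classical
  have hmm : (0:ℝ) < m := by exact_mod_cast hm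
  have hY : (fun ω : Omega d m σm σp => Y s w (n+1) ω) =
      ∑ p : (Fin n → Fin m) × Fin m, (fun ω => (if ext w p.1 then Wt s ω p.1 else 0)) *
        (fun ω => al s ω ⟨n, (Fin.snoc p.1 p.2 : Fin (n+1) → Fin m)⟩) := by
    funext ω
    rw [Finset.sum_apply]
    simp only [Pi.mul_apply]
    rw [Fintype.sum_prod_type]
    unfold Y
    rw [sum_snoc]
    refine Finset.sum_congr rfl fun v _ => Finset.sum_congr rfl fun j _ => ?_
    simp only [ext_snoc hk, Wt_snoc h0]
    split_ifs <;> simp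
  have hZm : ∀ v : Fin n → Fin m, Measurable[Fk d m σm σp n]
      (fun ω : Omega d m σm σp => (if ext w v then Wt s ω v else 0)) := by
    intro v
    rw [Fk_eq]
    split_ifs
    · exact Wt_meas h0 s v (fun u hu => hu)
    · exact measurable_const
  have hai : ∀ u : JW m, Integrable (fun ω => al s ω u) P := fun u =>
    bint (al_meas' s u) 1 fun ω => ab h0 h1 hs ω u
  have hint : ∀ p : (Fin n → Fin m) × Fin m, Integrable ((fun ω => (if ext w p.1 then Wt s ω p.1 else 0)) *
        (fun ω => al s ω ⟨n, (Fin.snoc p.1 p.2 : Fin (n+1) → Fin m)⟩)) P := by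
    intro p
    refine bint (((hZm p.1).mono (Fk_le n) le_rfl).mul (al_meas' s _)) 1 fun ω => ?_
    refine mulb ?_ (ab h0 h1 hs _ _)
    split_ifs
    · exact Wb h0 h1 hs _ _
    · simp
  rw [hY]
  refine EventuallyEq.trans ?_ (condExp_finsetSum (fun p _ => hint p) _).symm
  have hc : ∀ p : (Fin n → Fin m) × Fin m, P[(fun ω => (if ext w p.1 then Wt s ω p.1 else 0)) *
        (fun ω => al s ω ⟨n, (Fin.snoc p.1 p.2 : Fin (n+1) → Fin m)⟩) | Fk d m σm σp n] =ᵐ[P]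
        fun ω => (if ext w p.1 then Wt s ω p.1 else 0) * (1 / m) := by
    intro p
    have e1 := condExp_mul_of_stronglyMeasurable_left (hZm p.1).stronglyMeasurable (hint p) (hai _)
    have e2 : P[(fun ω => al s ω ⟨n, (Fin.snoc p.1 p.2 : Fin (n+1) → Fin m)⟩) | Fk d m σm σp n] =ᵐ[P]
        fun _ => ∫ ω, al s ω ⟨n, (Fin.snoc p.1 p.2 : Fin (n+1) → Fin m)⟩ ∂P :=
      al_condExp hI _ n (by simp)
    filter_upwards [e1, e2] with ω h1 h2
    rw [h1, Pi.mul_apply, h2, hE]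
  have hall : ∀ᵐ ω ∂P, ∀ p : (Fin n → Fin m) × Fin m, (P[(fun ω => (if ext w p.1 then Wt s ω p.1 else 0)) *
        (fun ω => al s ω ⟨n, (Fin.snoc p.1 p.2 : Fin (n+1) → Fin m)⟩) | Fk d m σm σp n]) ω =
        (if ext w p.1 then Wt s ω p.1 else 0) * (1 / m) := ae_all_iff.2 hc
  filter_upwards [hall] with ω hω
  rw [Finset.sum_apply, Finset.sum_congr rfl (fun p _ => hω p), Fintype.sum_prod_type]
  unfold Y
  refine Finset.sum_congr rfl fun v _ => ?_
  simp
  field_simp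

end prob

section limit

variable {d m : ℕ} {σm σp : ℝ}

theorem Fk_mono {i j : ℕ} (h : i ≤ j) : Fk d m σm σp i ≤ Fk d m σm σp j := by
  rw [Fk_eq, Fk_eq]
  exact GS_mono fun u hu => le_trans hu h

def FF (d m : ℕ) (σm σp : ℝ) (k : ℕ) :
    Filtration ℕ (inferInstance : MeasurableSpace (Omega d m σm σp)) where
  seq n := Fk d m σm σp (k + n)
  mono' _ _ h := Fk_mono (Nat.add_le_add_left h k)
  le' n := Fk_le (k + n)

variable {P : Measure (Omega d m σm σp)} [IsProbabilityMeasure P]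

theorem Y_UI (h0 : 0 < σm) (h1 : σp < 1) {s : ℝ} (hs : 0 < s) (hm : 0 < m)
    (hI : iIndepFun (fun (u : JW m) (ω : Omega d m σm σp) => ω u) P)
    (hE : ∀ u : JW m, ∫ ω, al s ω u ∂P = 1 / m) {k : ℕ} (w : Fin k → Fin m) :
    UniformIntegrable (fun (n : ℕ) (ω : Omega d m σm σp) => Y s w (k + n) ω) 1 P := by
  obtain ⟨C, hC⟩ := Ysq_bdd (P := P) h0 h1 hs hm hI hE
  refine uniformIntegrable_of le_rfl ENNReal.one_ne_top
    (fun n => (Y_meas' h0 s w _).aestronglyMeasurable) fun ε hε => ?_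
  obtain ⟨K, hK0, hK⟩ : ∃ K : NNReal, 0 < K ∧ C / K ≤ ε := by
    refine ⟨Real.toNNReal (|C| / ε + 1), ?_, ?_⟩
    · rw [Real.toNNReal_pos]; positivity
    · rw [Real.coe_toNNReal _ (by positivity), div_le_iff₀ (by positivity), mul_add,
        mul_div_cancel₀ _ hε.ne']
      have := le_abs_self C
      linarith
  refine ⟨K, fun n => ?_⟩
  rw [eLpNorm_one_eq_lintegral_enorm]
  have hK0' : (0:ℝ) < K := by exact_mod_cast hK0
  calc _ ≤ ∫⁻ ω, ENNReal.ofReal (Y s w (k + n) ω ^ 2 / K) ∂P := by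
        refine lintegral_mono fun ω => ?_
        by_cases h : ω ∈ {x | K ≤ ‖Y s w (k + n) x‖₊}
        · simp only [Set.indicator_of_mem h]
          rw [Real.enorm_eq_ofReal_abs]
          refine ENNReal.ofReal_le_ofReal ?_
          have h' : (K:ℝ) ≤ |Y s w (k+n) ω| := by
            have : K ≤ ‖Y s w (k + n) ω‖₊ := h
            exact_mod_cast this
          rw [le_div_iff₀ hK0', ← sq_abs]
          nlinarith [abs_nonneg (Y s w (k+n) ω)]
        · simp only [Set.indicator_of_notMem h]; simp
    _ = ENNReal.ofReal (∫ ω, Y s w (k + n) ω ^ 2 / K ∂P) := by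
        rw [ofReal_integral_eq_lintegral_ofReal ((Ysq_int h0 h1 hs w _).div_const _)]
        exact ae_of_all _ fun ω => by positivity
    _ ≤ _ := by
        refine ENNReal.ofReal_le_ofReal ?_
        rw [integral_div]
        exact le_trans (div_le_div_of_nonneg_right (hC k w _) hK0'.le) hK

theorem Y_limit (h0 : 0 < σm) (h1 : σp < 1) {s : ℝ} (hs : 0 < s) (hm : 0 < m)
    (hI : iIndepFun (fun (u : JW m) (ω : Omega d m σm σp) => ω u) P)
    (hE : ∀ u : JW m, ∫ ω, al s ω u ∂P = 1 / m) {k : ℕ} (w : Fin k → Fin m) :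
    ∃ X : Omega d m σm σp → ℝ, Integrable X P ∧
      (∀ᵐ ω ∂P, Tendsto (fun n => Y s w n ω) atTop (𝓝 (X ω))) ∧
      P[X | Fk d m σm σp k] =ᵐ[P] fun ω => Wt s ω w := by
  have hmart : Martingale (fun (n : ℕ) (ω : Omega d m σm σp) => Y s w (k + n) ω)
      (FF d m σm σp k) P := by
    refine martingale_nat (fun n => (Y_meas h0 s w (k + n)).stronglyMeasurable)
      (fun n => Y_int h0 h1 hs w _) fun n => ?_
    exact Y_condExp h0 h1 hs hm hI hE (Nat.le_add_right k n) w
  have hUI := Y_UI (P := P) h0 h1 hs hm hI hE w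
  obtain ⟨R, hR⟩ := hUI.2.2
  refine ⟨Filtration.limitProcess (fun n ω => Y s w (k + n) ω) (FF d m σm σp k) P, ?_, ?_, ?_⟩
  · exact (Filtration.memLp_limitProcess_of_eLpNorm_bdd hUI.1 hR).integrable le_rfl
  · filter_upwards [hmart.submartingale.ae_tendsto_limitProcess hR] with ω hω
    rw [← tendsto_add_atTop_iff_nat k]
    simpa only [add_comm] using hω
  · have := hmart.ae_eq_condExp_limitProcess hUI 0
    refine EventuallyEq.trans this.symm (ae_of_all _ fun ω => ?_)
    exact Y_self s w ω

/-- truncated total mass -/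
noncomputable def MN (s : ℝ) (N n : ℕ) (ω : Omega d m σm σp) : ℝ :=
  ∑ v : Fin n → Fin m, ∏ j : Fin n,
    if j.1 < N then 1 else al s ω ⟨j.1, fun t => v (Fin.castLE j.2 t)⟩

theorem MN_meas (s : ℝ) (N n : ℕ) {S : Set (JW m)} (hS : ∀ u : JW m, N ≤ u.1 → u ∈ S) :
    Measurable[GS d m σm σp S] (fun ω : Omega d m σm σp => MN s N n ω) := by
  unfold MN
  refine Finset.measurable_fun_sum _ fun v _ => Finset.measurable_fun_prod _ fun j _ => ?_
  split_ifs with h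
  · exact measurable_const
  · exact al_meas s (hS _ (not_lt.1 h))

theorem MN_bounds (h0 : 0 < σm) (h1 : σp < 1) {s : ℝ} (hs : 0 < s) (N n : ℕ)
    (ω : Omega d m σm σp) :
    0 ≤ MN s N n ω ∧ M s n ω ≤ MN s N n ω ∧ min 1 (σm ^ s) ^ N * MN s N n ω ≤ M s n ω := by
  set c := min 1 (σm ^ s) with hc
  have hc0 : 0 < c := lt_min one_pos (Real.rpow_pos_of_pos h0 _)
  have hc1 : c ≤ 1 := min_le_left _ _
  have hca : ∀ u, c ≤ al s ω u := fun u => (min_le_right _ _).trans (al_ge h0 hs ω u)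
  have hnn : ∀ v : Fin n → Fin m, 0 ≤ ∏ j : Fin n,
    if j.1 < N then 1 else al s ω ⟨j.1, fun t => v (Fin.castLE j.2 t)⟩ := fun v =>
      Finset.prod_nonneg fun j _ => by
        split_ifs
        exacts [zero_le_one, (al_pos h0 _ _ _).le]
  have hsplit : ∀ v : Fin n → Fin m, Wt s ω v =
      (∏ j : Fin n, if j.1 < N then al s ω ⟨j.1, fun t => v (Fin.castLE j.2 t)⟩ else 1) *
      ∏ j : Fin n, if j.1 < N then 1 else al s ω ⟨j.1, fun t => v (Fin.castLE j.2 t)⟩ := by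
    intro v
    rw [Wt_eq_prod h0, ← Finset.prod_mul_distrib]
    refine Finset.prod_congr rfl fun j _ => ?_
    split_ifs <;> simp
  refine ⟨Finset.sum_nonneg fun v _ => hnn v, Finset.sum_le_sum fun v _ => ?_, ?_⟩
  · rw [hsplit]
    refine mul_le_of_le_one_left (hnn v) (Finset.prod_le_one (fun j _ => ?_) fun j _ => ?_)
    · split_ifs
      exacts [(al_pos h0 _ _ _).le, zero_le_one]
    · split_ifs
      exacts [al_le_one h0 h1 hs _ _, le_rfl]
  · unfold MN M
    rw [Finset.mul_sum]
    refine Finset.sum_le_sum fun v _ => ?_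
    rw [hsplit]
    refine mul_le_mul_of_nonneg_right ?_ (hnn v)
    calc c ^ N ≤ ∏ j : Fin n, if j.1 < N then c else 1 := by
          rw [Fin.prod_univ_eq_prod_range (fun j => if j < N then c else 1) n, Finset.prod_ite]
          simp only [Finset.prod_const, one_pow, mul_one]
          refine pow_le_pow_of_le_one hc0.le hc1 ?_
          calc _ ≤ (Finset.range N).card := Finset.card_le_card fun x hx => by
                simp at hx ⊢; exact hx.2
            _ = N := by simp
      _ ≤ _ := by
          refine Finset.prod_le_prod (fun j _ => ?_) fun j _ => ?_
          · split_ifs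
            exacts [hc0.le, zero_le_one]
          · split_ifs
            exacts [hca _, le_rfl]

theorem M_tendsto_iff (h0 : 0 < σm) (h1 : σp < 1) {s : ℝ} (hs : 0 < s) (N : ℕ)
    (ω : Omega d m σm σp) :
    Tendsto (fun n => M s n ω) atTop (𝓝 0) ↔ Tendsto (fun n => MN s N n ω) atTop (𝓝 0) := by
  have hc0 : 0 < min 1 (σm ^ s) ^ N := pow_pos (lt_min one_pos (Real.rpow_pos_of_pos h0 _)) _
  constructor
  · intro h
    have h2 := h.const_mul (min 1 (σm ^ s) ^ N)⁻¹
    rw [mul_zero] at h2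
    refine squeeze_zero (fun n => (MN_bounds h0 h1 hs N n ω).1) (fun n => ?_) h2
    rw [le_inv_mul_iff₀ hc0]
    exact (MN_bounds h0 h1 hs N n ω).2.2
  · intro h
    exact squeeze_zero (fun n => Finset.sum_nonneg fun v _ => (Wt_pos h0 s ω v).le)
      (fun n => (MN_bounds h0 h1 hs N n ω).2.1) h

theorem tail01 (h0 : 0 < σm) (h1 : σp < 1) {s : ℝ} (hs : 0 < s)
    (hI : iIndepFun (fun (u : JW m) (ω : Omega d m σm σp) => ω u) P) :
    P {ω | Tendsto (fun n => M s n ω) atTop (𝓝 0)} = 0 ∨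
    P {ω | Tendsto (fun n => M s n ω) atTop (𝓝 0)} = 1 := by
  have hfin : ∀ a : ℕ, {u : JW m | u.1 ≤ a}.Finite := by
    intro a
    have : {u : JW m | u.1 ≤ a} ⊆ ⋃ k ∈ Set.Iic a, Set.range (fun v : Fin (k+1) → Fin m => (⟨k, v⟩ : JW m)) := by
      rintro ⟨k, v⟩ hk
      simp only [Set.mem_iUnion]
      exact ⟨k, hk, v, rfl⟩
    exact ((Set.finite_Iic a).biUnion fun k _ => Set.finite_range _).subset this
  refine measure_zero_or_one_of_measurableSet_limsup
    (s := fun u : JW m => MeasurableSpace.comap (fun ω : Omega d m σm σp => ω u) inferInstance)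
    (f := cofinite) (p := Set.Finite) (ns := fun a : ℕ => {u : JW m | u.1 ≤ a})
    (fun u => (measurable_pi_apply u).comap_le) hI (fun t ht => ht.compl_mem_cofinite)
    (Monotone.directed_le fun i j h u hu => le_trans hu h) hfin (fun u => ⟨u.1, le_refl u.1⟩) ?_
  rw [limsup_eq_iInf_iSup]
  simp only [MeasurableSpace.measurableSet_iInf]
  intro t ht
  obtain ⟨N, hN⟩ : ∃ N, ∀ u : JW m, N ≤ u.1 → u ∈ t := by
    have hf : (tᶜ).Finite := ht
    obtain ⟨B, hB⟩ := (hf.image (fun u : JW m => u.1)).bddAbove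
    refine ⟨B + 1, fun u hu => ?_⟩
    by_contra hc
    have : u.1 ≤ B := hB ⟨u, hc, rfl⟩
    omega
  have : {ω : Omega d m σm σp | Tendsto (fun n => M s n ω) atTop (𝓝 0)} =
      {ω | Tendsto (fun n => MN s N n ω) atTop (𝓝 0)} := by
    ext ω; exact M_tendsto_iff h0 h1 hs N ω
  rw [this]
  exact measurableSet_tendsto (𝓝 (0:ℝ)) (fun n => MN_meas s N n hN)

end limit

section law

variable {d m : ℕ} {σm σp : ℝ}

theorem law_coord {θ : Measure (Od d)} {P : Measure (Omega d m σm σp)} (h : IsProductLaw θ P)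
    (u : JW m) {A : Set (Label d σm σp)} (hA : MeasurableSet A) :
    P ((fun ω => ω u) ⁻¹' A) = labelM σm σp θ A := by
  have := h {u} (fun _ => A) (fun _ => hA)
  simp only [Finset.mem_singleton, forall_eq, Finset.prod_singleton] at this
  exact this

theorem law_indep {θ : Measure (Od d)} {P : Measure (Omega d m σm σp)} (h : IsProductLaw θ P) :
    iIndepFun (fun (u : JW m) (ω : Omega d m σm σp) => ω u) P := by
  classical
  rw [iIndepFun_iff_measure_inter_preimage_eq_mul]
  intro S A hA
  have h1 := h S (fun w => if w ∈ S then A w else Set.univ) (by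
    intro w
    split_ifs with hw
    exacts [hA w hw, MeasurableSet.univ])
  have e1 : {ω : Omega d m σm σp | ∀ w ∈ S, ω w ∈ (if w ∈ S then A w else Set.univ)} =
      ⋂ i ∈ S, (fun ω : Omega d m σm σp => ω i) ⁻¹' A i := by
    ext ω
    simp only [Set.mem_iInter, Set.mem_preimage]
    constructor
    · intro H i hi
      have := H i hi
      rwa [if_pos hi] at this
    · intro H i hi
      rw [if_pos hi]; exact H i hi
  rw [← e1, h1]
  refine Finset.prod_congr rfl fun i hi => ?_
  rw [if_pos hi, law_coord h i (hA i hi)]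

theorem law_E {θ : Measure (Od d)} [IsProbabilityMeasure θ] {P : Measure (Omega d m σm σp)}
    (h : IsProductLaw θ P) (hm : 0 < m) (hlt : σm < σp) {s : ℝ}
    (hs : ((m : ℝ) / (σp - σm)) * (∫ r in σm..σp, r ^ s) = 1) (u : JW m) :
    ∫ ω, al s ω u ∂P = 1 / m := by
  have hmap : P.map (fun ω => ω u) = labelM σm σp θ := by
    ext A hA
    rw [Measure.map_apply (measurable_pi_apply u) hA, law_coord h u hA]
  have hf : Measurable (fun x : Label d σm σp => (x.1 : ℝ) ^ s) := by fun_prop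
  have e1 : ∫ ω, al s ω u ∂P = ∫ x, (x.1 : ℝ) ^ s ∂(labelM σm σp θ) := by
    rw [← hmap, integral_map (measurable_pi_apply u).aemeasurable hf.aestronglyMeasurable]
    rfl
  have : SFinite (unifSub σm σp) := by
    unfold unifSub
    have : IsFiniteMeasure ((volume : Measure ℝ).comap (Subtype.val : Set.Ioo σm σp → ℝ)) := by
      constructor
      rw [comap_subtype_coe_apply measurableSet_Ioo, Set.image_univ, Subtype.range_coe]
      exact measure_Ioo_lt_top
    infer_instance
  have e2 : ∫ x, (x.1 : ℝ) ^ s ∂(labelM σm σp θ) = ∫ r : Set.Ioo σm σp, (r : ℝ) ^ s ∂(unifSub σm σp) := by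
    unfold labelM
    rw [integral_fun_fst (fun r : Set.Ioo σm σp => (r : ℝ) ^ s)]
    simp
  have e3 : ∫ r : Set.Ioo σm σp, (r : ℝ) ^ s ∂(unifSub σm σp) = (σp - σm)⁻¹ * ∫ r in σm..σp, r ^ s := by
    unfold unifSub
    rw [integral_smul_measure, integral_subtype_comap measurableSet_Ioo (fun r : ℝ => r ^ s),
      intervalIntegral.integral_of_le hlt.le, integral_Ioc_eq_integral_Ioo]
    rw [ENNReal.toReal_inv, ENNReal.toReal_ofReal (by linarith), smul_eq_mul]
  have hmm : (0:ℝ) < m := by exact_mod_cast hm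
  rw [e1, e2, e3]
  rw [eq_div_iff hmm.ne', ← hs]
  ring

end law

theorem stmt13 (d m : ℕ) (hd : 1 ≤ d) (hm : 2 ≤ m)
    (σm σp : ℝ) (hσ0 : 0 < σm) (hσ1 : σm ≤ σp) (hσ2 : σp < 1)
    (θ : Measure (Od d)) (hθ1 : IsProbabilityMeasure θ) (hθ2 : θ.IsMulLeftInvariant)
    (P : Measure (Omega d m σm σp)) (hP1 : IsProbabilityMeasure P)
    (hP2 : IsProductLaw θ P)
    (s : ℝ) (hs0 : 0 < s)
    (hs : ((m : ℝ) / (σp - σm)) * (∫ r in σm..σp, r ^ s) = 1) :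
    ∃ μ : Omega d m σm σp → Measure (ℕ → Fin m),
      (∀ ω, IsFiniteMeasure (μ ω)) ∧
      (∀ (k : ℕ) (w : Fin k → Fin m), Measurable fun ω => μ ω (cyl w)) ∧
      (∀ᵐ ω ∂P, 0 < μ ω Set.univ ∧ μ ω Set.univ < ⊤) ∧
      (∀ k : ℕ, 1 ≤ k → ∀ w : Fin k → Fin m,
        MeasureTheory.condExp (Fk d m σm σp k) P (fun ω => (μ ω (cyl w)).toReal)
          =ᵐ[P] fun ω => wordR ω w ^ s) ∧
      (∀ k : ℕ, 1 ≤ k →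
        ∫ ω, (∑ w : Fin k → Fin m, (μ ω (cyl w)).toReal) ∂P = 1) := by
  have hlt : σm < σp := by
    rcases hσ1.lt_or_eq with h | h
    · exact h
    · subst h; simp at hs
  have hm0 : 0 < m := by omega
  have hI := law_indep hP2
  have hE := law_E (s := s) hP2 hm0 hlt hs
  let z : Fin m := ⟨0, hm0⟩
  let G : Set (Omega d m σm σp) :=
    {ω | ∀ (k : ℕ) (w : Fin k → Fin m), ∃ l, Tendsto (fun n => Y s w n ω) atTop (𝓝 l)}
  have hGm : MeasurableSet G := by
    have : G = ⋂ (k : ℕ), ⋂ (w : Fin k → Fin m), {ω | ∃ l, Tendsto (fun n => Y s w n ω) atTop (𝓝 l)} := by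
      ext ω; simp [G]
    rw [this]
    exact MeasurableSet.iInter fun k => MeasurableSet.iInter fun w =>
      measurableSet_exists_tendsto fun n => Y_meas' hσ0 s w n
  have hex : ∀ ω : Omega d m σm σp, ∃ μ : FiniteMeasure (ℕ → Fin m), ∀ (k : ℕ) (w : Fin k → Fin m),
      Tendsto (fun n => G.indicator (fun ω => Y s w n ω) ω) atTop
        (𝓝 ((μ : Measure (ℕ → Fin m)).real (cyl w))) := by
    intro ω
    by_cases hω : ω ∈ G
    · have hω' := hω
      choose L hL using hω'
      obtain ⟨μ, hμ⟩ := exists_lim_measure (fun n => (⟨nu z s n ω, nu_finite z s n ω⟩ : FiniteMeasure (ℕ → Fin m))) L (by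
        intro k w
        refine (hL k w).congr' ?_
        filter_upwards [eventually_ge_atTop k] with n hn
        exact (nu_cyl hσ0 z s hn w ω).symm)
      refine ⟨μ, fun k w => ?_⟩
      rw [hμ]
      simpa only [Set.indicator_of_mem hω] using hL k w
    · refine ⟨0, fun k w => ?_⟩
      simp [Set.indicator_of_notMem hω]
  choose μ hμ using hex
  have hGae : ∀ᵐ ω ∂P, ω ∈ G := by
    simp only [G, Set.mem_ofPred_eq]
    rw [ae_all_iff]; intro k
    rw [ae_all_iff]; intro w
    obtain ⟨X, -, hX, -⟩ := Y_limit (P := P) hσ0 hσ2 hs0 hm0 hI hE w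
    filter_upwards [hX] with ω h
    exact ⟨_, h⟩
  have hXm : ∀ (k : ℕ) (w : Fin k → Fin m), Measurable fun ω => (μ ω : Measure (ℕ → Fin m)).real (cyl w) := by
    intro k w
    refine measurable_of_tendsto_metrizable (fun n => (Y_meas' hσ0 s w n).indicator hGm)
      (tendsto_pi_nhds.2 fun ω => hμ ω k w)
  have hlim : ∀ (k : ℕ) (w : Fin k → Fin m), ∀ᵐ ω ∂P,
      Tendsto (fun n => Y s w n ω) atTop (𝓝 ((μ ω : Measure (ℕ → Fin m)).real (cyl w))) := by
    intro k w
    filter_upwards [hGae] with ω h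
    simpa only [Set.indicator_of_mem h] using hμ ω k w
  have hmain : ∀ (k : ℕ) (w : Fin k → Fin m),
      Integrable (fun ω => (μ ω : Measure (ℕ → Fin m)).real (cyl w)) P ∧
      P[fun ω => (μ ω : Measure (ℕ → Fin m)).real (cyl w) | Fk d m σm σp k] =ᵐ[P] fun ω => Wt s ω w := by
    intro k w
    obtain ⟨X, h1, h2, h3⟩ := Y_limit (P := P) hσ0 hσ2 hs0 hm0 hI hE w
    have he : X =ᵐ[P] fun ω => (μ ω : Measure (ℕ → Fin m)).real (cyl w) := by
      filter_upwards [h2, hlim k w] with ω a b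
      exact tendsto_nhds_unique a b
    exact ⟨h1.congr he, (condExp_congr_ae he).symm.trans h3⟩
  have hu : cyl (Fin.elim0 : Fin 0 → Fin m) = Set.univ := by
    ext j; simp [cyl]
  have hE1 : ∫ ω, (μ ω : Measure (ℕ → Fin m)).real Set.univ ∂P = 1 := by
    rw [← hu, ← integral_condExp (Fk_le 0), integral_congr_ae (hmain 0 Fin.elim0).2]
    simp [Wt, wordR]
  refine ⟨fun ω => (μ ω : Measure (ℕ → Fin m)), fun ω => inferInstance, fun k w => ?_, ?_,
    fun k _ w => (hmain k w).2, fun k _ => ?_⟩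
  · have := (hXm k w).ennreal_ofReal
    simpa [Measure.real] using this
  · have hT : P {ω | Tendsto (fun n => M s n ω) atTop (𝓝 0)} = 0 := by
      rcases tail01 (P := P) hσ0 hσ2 hs0 hI with h | h
      · exact h
      · exfalso
        have hTm : MeasurableSet {ω : Omega d m σm σp | Tendsto (fun n => M s n ω) atTop (𝓝 0)} := by
          simp_rw [← Y_zero s (Fin.elim0 : Fin 0 → Fin m)]
          exact measurableSet_tendsto (𝓝 (0:ℝ)) (fun n => Y_meas' hσ0 s _ n)
        have h' : ∀ᵐ ω ∂P, Tendsto (fun n => M s n ω) atTop (𝓝 0) := by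
          rw [ae_iff]
          exact (prob_compl_eq_zero_iff hTm).2 h
        have : ∫ ω, (μ ω : Measure (ℕ → Fin m)).real Set.univ ∂P = 0 := by
          refine integral_eq_zero_of_ae ?_
          filter_upwards [h', hlim 0 Fin.elim0] with ω a b
          simp_rw [Y_zero, hu] at b
          exact tendsto_nhds_unique b a
        rw [hE1] at this
        exact one_ne_zero this
    have hT' : ∀ᵐ ω ∂P, ¬ Tendsto (fun n => M s n ω) atTop (𝓝 0) := by
      rw [ae_iff]; simpa using hT
    filter_upwards [hT', hlim 0 Fin.elim0] with ω a b
    refine ⟨?_, measure_lt_top _ _⟩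
    rw [pos_iff_ne_zero]
    intro h
    apply a
    simp_rw [Y_zero, hu] at b
    rwa [Measure.real, h, ENNReal.toReal_zero] at b
  · rw [← hE1]
    refine integral_congr_ae (ae_of_all _ fun ω => ?_)
    have hU : (Set.univ : Set (ℕ → Fin m)) = ⋃ w : Fin k → Fin m, cyl w := by
      ext j
      simp only [Set.mem_univ, Set.mem_iUnion, true_iff]
      exact ⟨fun t => j t.1, fun t => rfl⟩
    have hd' : Pairwise (Function.onFun Disjoint (fun w : Fin k → Fin m => cyl w)) := by
      intro w w' hne
      rw [Function.onFun, Set.disjoint_left]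
      intro j h1 h2
      apply hne
      funext t
      rw [← h1 t, ← h2 t]
    simp only [Measure.real]
    rw [hU, measure_iUnion hd' (fun w => (isClopen_cyl w).isOpen.measurableSet), tsum_fintype,
      ENNReal.toReal_sum (fun w _ => measure_ne_top _ _)]
end
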